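/- If G is a 5-regular (finite simple) graph with girth 4 (i.e., G is triangle-free and contains a 4-cycle), then G has a strong edge-coloring that uses at most 37 colors; that is, χ'_s(G) ≤ 37. -/

import Mathlib

open SimpleGraph

/-- Two edges (given as elements of `Sym2 V`) are at distance at most two in `G`:
they share an endpoint, or some endpoint of one is adjacent to some endpoint of the other. -/
def EdgesNear {V : Type*} (G : SimpleGraph V) (e f : Sym2 V) : Prop :=
  (∃ x, x ∈ e ∧ x ∈ f) ∨ (∃ x y, x ∈ e ∧ y ∈ f ∧ G.Adj x y)

/-- A strong edge-coloring of `G` with colors in `Fin k`: any two distinct edges at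
distance at most two receive different colors. -/
def IsStrongEdgeColoring {V : Type*} (G : SimpleGraph V) {k : ℕ}
    (c : G.edgeSet → Fin k) : Prop :=
  ∀ e f : G.edgeSet, e ≠ f → EdgesNear G (e : Sym2 V) (f : Sym2 V) → c e ≠ c f

section

open Finset
open scoped Classical

noncomputable section

section ListColoring

variable {E : Type*} [Fintype E] [DecidableEq E] (K : SimpleGraph E)

/-- The coloring `c` is proper for `K` on the set `S`. -/
def ProperOn (S : Finset E) (c : E → Fin 37) : Prop :=
  ∀ e ∈ S, ∀ f ∈ S, K.Adj e f → c e ≠ c f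

/-- The number of colors seen by `e` in a coloring of `S`, plus the number of its neighbors
outside `S`: an upper bound for the number of colors `e` sees in any extension. -/
def demand (S : Finset E) (c : E → Fin 37) (e : E) : ℕ :=
  #((K.neighborFinset e ∩ S).image c) + #(K.neighborFinset e \ S)

variable {K}

lemma demand_mono {S S' : Finset E} {c c' : E → Fin 37} (hS : S ⊆ S')
    (hc : ∀ e ∈ S, c' e = c e) (e : E) : demand K S' c' e ≤ demand K S c e := by
  have h1 : (K.neighborFinset e ∩ S').image c' ⊆
      (K.neighborFinset e ∩ S).image c ∪ ((K.neighborFinset e \ S) ∩ S').image c' := by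
    intro x hx
    simp only [mem_image, mem_union, mem_inter, mem_sdiff] at hx ⊢
    obtain ⟨f, ⟨hf, hf'⟩, rfl⟩ := hx
    by_cases h : f ∈ S
    · exact Or.inl ⟨f, ⟨hf, h⟩, (hc f h).symm⟩
    · exact Or.inr ⟨f, ⟨⟨hf, h⟩, hf'⟩, rfl⟩
  have h2 := (card_le_card h1).trans (card_union_le _ _)
  have h3 : #(((K.neighborFinset e \ S) ∩ S').image c') ≤ #((K.neighborFinset e \ S) ∩ S') :=
    card_image_le
  have h4 : #((K.neighborFinset e \ S) ∩ S') + #(K.neighborFinset e \ S')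
      = #(K.neighborFinset e \ S) := by
    rw [← card_inter_add_card_sdiff (K.neighborFinset e \ S) S', sdiff_sdiff_left,
      sup_eq_union, union_eq_right.2 hS]
  unfold demand
  omega

lemma demand_le_degree (S : Finset E) (c : E → Fin 37) (e : E) :
    demand K S c e ≤ #(K.neighborFinset e) := by
  have h : #((K.neighborFinset e ∩ S).image c) ≤ #(K.neighborFinset e ∩ S) := card_image_le
  have := card_inter_add_card_sdiff (K.neighborFinset e) S
  unfold demand
  omega

lemma demand_add_card_le {S : Finset E} {c : E → Fin 37} {e : E}
    (hS : S ⊆ K.neighborFinset e) :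
    demand K S c e + #S ≤ #(K.neighborFinset e) + #(S.image c) := by
  have := card_inter_add_card_sdiff (K.neighborFinset e) S
  unfold demand
  rw [inter_eq_right.2 hS] at *
  omega

lemma exists_extend_one {S : Finset E} {c : E → Fin 37} (hc : ProperOn K S c) {e : E}
    (he : e ∉ S) {x : Fin 37} (hx : x ∉ (K.neighborFinset e ∩ S).image c) :
    ProperOn K (insert e S) (Function.update c e x) := by
  have hne : ∀ f ∈ S, f ≠ e := fun f hf h => he (h ▸ hf)
  have hx' : ∀ f ∈ S, K.Adj e f → c f ≠ x := by
    intro f hf h h'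
    exact hx (mem_image.2 ⟨f, mem_inter.2 ⟨by simpa using h, hf⟩, h'⟩)
  intro f hf g hg hfg
  rcases mem_insert.1 hf with rfl | hf <;> rcases mem_insert.1 hg with rfl | hg
  · exact absurd hfg (K.loopless.irrefl _)
  · rw [Function.update_self, Function.update_of_ne (hne g hg)]
    exact (hx' g hg hfg).symm
  · rw [Function.update_self, Function.update_of_ne (hne f (by assumption))]
    exact hx' f (by assumption) hfg.symm
  · rw [Function.update_of_ne (hne f hf), Function.update_of_ne (hne g hg)]
    exact hc f hf g hg hfg

/-- Greedy extension in order of decreasing `ρ`. -/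
lemma exists_greedy_extension (ρ : E → ℕ) {S : Finset E} {c : E → Fin 37}
    (hc : ProperOn K S c) (T : Finset E)
    (hT : ∀ e ∈ T, demand K S c e ≤
      36 + #{f ∈ K.neighborFinset e \ S | f ∉ T ∨ ρ f < ρ e}) :
    ∃ c', ProperOn K (S ∪ T) c' ∧ ∀ e ∈ S, c' e = c e := by
  induction hn : #T generalizing T with
  | zero => exact ⟨c, by simpa [card_eq_zero.1 hn] using hc, fun _ _ => rfl⟩
  | succ n ih =>
    have hne : T.Nonempty := card_pos.1 (by omega)
    obtain ⟨e, heT, hmin⟩ := exists_min_image T ρ hne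
    obtain ⟨c₁, hc₁, hcS⟩ := ih (T.erase e) (fun f hf => by
      refine (hT f (mem_of_mem_erase hf)).trans (Nat.add_le_add_left (card_le_card ?_) _)
      intro g hg
      simp only [mem_filter, mem_erase] at hg ⊢
      tauto) (by rw [card_erase_of_mem heT, hn]; rfl)
    by_cases heS : e ∈ S
    · refine ⟨c₁, ?_, hcS⟩
      have : S ∪ T.erase e = S ∪ T := by
        ext f; by_cases h : f = e <;> simp [h, heS]
      rwa [this] at hc₁
    have heU : e ∉ S ∪ T.erase e := by simp [heS]
    have hd := (demand_mono (K := K) (subset_union_left (s₂ := T.erase e)) hcS e).trans (hT e heT)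
    have hsub : {f ∈ K.neighborFinset e \ S | f ∉ T ∨ ρ f < ρ e} ⊆
        K.neighborFinset e \ (S ∪ T.erase e) := by
      intro f hf
      simp only [mem_filter, mem_sdiff, mem_union, mem_erase] at hf ⊢
      refine ⟨hf.1.1, ?_⟩
      rintro (h | h)
      · exact hf.1.2 h
      · rcases hf.2 with h' | h'
        · exact h' h.2
        · exact absurd (hmin f h.2) (by omega)
    have hcard := card_le_card hsub
    unfold demand at hd
    obtain ⟨x, hx⟩ : ∃ x, x ∉ (K.neighborFinset e ∩ (S ∪ T.erase e)).image c₁ := by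
      by_contra! h
      have := card_le_card (show (univ : Finset (Fin 37)) ⊆ _ from fun x _ => h x)
      rw [card_univ, Fintype.card_fin] at this
      omega
    refine ⟨Function.update c₁ e x, ?_, ?_⟩
    · have := exists_extend_one hc₁ heU hx
      rwa [← union_insert, insert_erase heT] at this
    · intro f hf
      rw [Function.update_of_ne (by rintro rfl; exact heS hf)]
      exact hcS f hf

/-- Coloring `p`, `q`, or both with one color so that the demand of `f` drops, when the lists of
`p` and `q` together are larger than that of `f`. -/
lemma exists_extension_demand_lt {S : Finset E} {c : E → Fin 37} (hc : ProperOn K S c)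
    {p q f : E} (hp : p ∉ S) (hq : q ∉ S) (hpq : p ≠ q) (hnadj : ¬ K.Adj p q)
    (hfp : K.Adj f p) (hfq : K.Adj f q)
    (hcard : #((K.neighborFinset p ∩ S).image c) + #((K.neighborFinset q ∩ S).image c) <
      37 + #((K.neighborFinset f ∩ S).image c)) :
    ∃ (S' : Finset E) (c' : E → Fin 37), S ⊆ S' ∧ S' ⊆ insert p (insert q S) ∧
      ProperOn K S' c' ∧ (∀ e ∈ S, c' e = c e) ∧ demand K S' c' f < demand K S c f := by
  have single : ∀ r, r ∉ S → K.Adj f r → ∀ x, x ∉ (K.neighborFinset r ∩ S).image c →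
      x ∈ (K.neighborFinset f ∩ S).image c →
      demand K (insert r S) (Function.update c r x) f < demand K S c f := by
    intro r hr hfr x _ hx
    have himg : (K.neighborFinset f ∩ insert r S).image (Function.update c r x) ⊆
        (K.neighborFinset f ∩ S).image c := by
      intro y hy
      obtain ⟨g, hg, rfl⟩ := mem_image.1 hy
      by_cases hgr : g = r
      · subst hgr; simpa using hx
      · rw [Function.update_of_ne hgr]
        exact mem_image_of_mem _ (by simp only [mem_inter, mem_insert] at hg ⊢; tauto)
    have h1 := card_le_card himg
    have h2 : #(K.neighborFinset f \ insert r S) < #(K.neighborFinset f \ S) := by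
      apply card_lt_card
      refine ⟨sdiff_subset_sdiff le_rfl (subset_insert _ _), fun h => ?_⟩
      have := h (mem_sdiff.2 ⟨by simpa using hfr, hr⟩)
      simp at this
    unfold demand
    omega
  by_cases hcom : ∃ x, x ∉ (K.neighborFinset p ∩ S).image c ∧
      x ∉ (K.neighborFinset q ∩ S).image c
  · obtain ⟨x, hxp, hxq⟩ := hcom
    have hq' : q ∉ insert p S := by simp [hq, hpq.symm]
    have h1 := exists_extend_one hc hp hxp
    have himgq : (K.neighborFinset q ∩ insert p S).image (Function.update c p x) ⊆
        (K.neighborFinset q ∩ S).image c := by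
      intro y hy
      obtain ⟨g, hg, rfl⟩ := mem_image.1 hy
      have hgp : g ≠ p := by
        rintro rfl
        exact hnadj (by simpa using (mem_inter.1 hg).1 : K.Adj q g).symm
      rw [Function.update_of_ne hgp]
      exact mem_image_of_mem _ (by simp only [mem_inter, mem_insert] at hg ⊢; tauto)
    have h2 := exists_extend_one h1 hq' (fun h => hxq (himgq h))
    refine ⟨_, _, ?_, ?_, h2, ?_, ?_⟩
    · exact (subset_insert _ _).trans (subset_insert _ _)
    · rw [Finset.insert_comm]
    · intro e he
      rw [Function.update_of_ne (by rintro rfl; exact hq he),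
        Function.update_of_ne (by rintro rfl; exact hp he)]
    · refine lt_of_lt_of_le ?_ (demand_mono (subset_insert p S)
        (c' := Function.update c p x) ?_ f)
      · have himg : (K.neighborFinset f ∩ insert q (insert p S)).image
            (Function.update (Function.update c p x) q x) ⊆
            (K.neighborFinset f ∩ insert p S).image (Function.update c p x) := by
          intro y hy
          obtain ⟨g, hg, rfl⟩ := mem_image.1 hy
          by_cases hgq : g = q
          · subst hgq
            rw [Function.update_self]
            exact mem_image.2 ⟨p, by simpa using hfp, by simp⟩
          · rw [Function.update_of_ne hgq]
            exact mem_image_of_mem _ (by simp only [mem_inter, mem_insert] at hg ⊢; tauto)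
        have h1 := card_le_card himg
        have h2 : #(K.neighborFinset f \ insert q (insert p S)) <
            #(K.neighborFinset f \ insert p S) := by
          apply card_lt_card
          refine ⟨sdiff_subset_sdiff le_rfl (subset_insert _ _), fun h => ?_⟩
          have := h (mem_sdiff.2 ⟨by simpa using hfq, hq'⟩)
          simp at this
        unfold demand
        omega
      · intro e he
        rw [Function.update_of_ne (by rintro rfl; exact hp he)]
  · push Not at hcom
    obtain ⟨x, hx, hpq'⟩ : ∃ x, x ∈ (K.neighborFinset f ∩ S).image c ∧
        (x ∉ (K.neighborFinset p ∩ S).image c ∨ x ∉ (K.neighborFinset q ∩ S).image c) := by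
      by_contra! h
      have hunion : (univ : Finset (Fin 37)) ⊆
          (K.neighborFinset p ∩ S).image c ∪ (K.neighborFinset q ∩ S).image c := by
        intro x _
        by_cases hx : x ∈ (K.neighborFinset p ∩ S).image c
        · exact mem_union_left _ hx
        · exact mem_union_right _ (hcom x hx)
      have hinter : (K.neighborFinset f ∩ S).image c ⊆
          (K.neighborFinset p ∩ S).image c ∩ (K.neighborFinset q ∩ S).image c :=
        fun x hx => mem_inter.2 (h x hx)
      have h1 := card_le_card hunion
      have h2 := card_le_card hinter
      have h3 := card_union_add_card_inter ((K.neighborFinset p ∩ S).image c)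
        ((K.neighborFinset q ∩ S).image c)
      rw [card_univ, Fintype.card_fin] at h1
      omega
    rcases hpq' with hxp | hxq
    · refine ⟨_, _, subset_insert _ _, insert_subset_insert _ (subset_insert _ _),
        exists_extend_one hc hp hxp, ?_, single p hp hfp x hxp hx⟩
      intro e he
      rw [Function.update_of_ne (by rintro rfl; exact hp he)]
    · refine ⟨_, _, subset_insert _ _, subset_insert _ _,
        exists_extend_one hc hq hxq, ?_, single q hq hfq x hxq hx⟩
      intro e he
      rw [Function.update_of_ne (by rintro rfl; exact hq he)]

end ListColoring

section Graph

variable {V : Type*} {G : SimpleGraph V}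

/-- Adjacency of edges of `G` at distance at most two. -/
def conflictGraph (G : SimpleGraph V) : SimpleGraph (Sym2 V) where
  Adj e f := e ≠ f ∧ e ∈ G.edgeSet ∧ f ∈ G.edgeSet ∧ EdgesNear G e f
  symm := by
    constructor
    rintro e f ⟨h1, h2, h3, h4⟩
    refine ⟨h1.symm, h3, h2, ?_⟩
    rcases h4 with ⟨x, hx, hx'⟩ | ⟨x, y, hx, hy, h⟩
    · exact Or.inl ⟨x, hx', hx⟩
    · exact Or.inr ⟨y, x, hy, hx, h.symm⟩
  loopless := ⟨fun _ h => h.1 rfl⟩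

/-- `abcd` is a 4-cycle of `G`. -/
structure IsFourCycle (G : SimpleGraph V) (a b c d : V) : Prop where
  ab : G.Adj a b
  bc : G.Adj b c
  cd : G.Adj c d
  da : G.Adj d a
  ac : a ≠ c
  bd : b ≠ d

lemma IsFourCycle.rotate {a b c d : V} (h : IsFourCycle G a b c d) : IsFourCycle G b c d a :=
  ⟨h.bc, h.cd, h.da, h.ab, h.bd, h.ac.symm⟩

lemma IsFourCycle.reflect {a b c d : V} (h : IsFourCycle G a b c d) : IsFourCycle G a d c b :=
  ⟨h.da.symm, h.cd.symm, h.bc.symm, h.ab.symm, h.ac, h.bd.symm⟩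

/-- The edges of the 4-cycle `abcd`. -/
def cycleEdges (a b c d : V) : Finset (Sym2 V) := {s(a, b), s(b, c), s(c, d), s(d, a)}

lemma mem_cycleEdges {a b c d : V} {e : Sym2 V} :
    e ∈ cycleEdges a b c d ↔ e = s(a, b) ∨ e = s(b, c) ∨ e = s(c, d) ∨ e = s(d, a) := by
  simp [cycleEdges]

lemma IsFourCycle.card_cycleEdges {a b c d : V} (h : IsFourCycle G a b c d) :
    #(cycleEdges a b c d) = 4 := by
  have := h.ab.ne
  have := h.bc.ne
  have := h.cd.ne
  have := h.da.ne
  have := h.ac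
  have := h.bd
  rw [cycleEdges, card_insert_of_notMem, card_insert_of_notMem, card_insert_of_notMem,
    card_singleton] <;> simp only [mem_insert, mem_singleton, Sym2.eq_iff] <;> tauto

lemma IsFourCycle.mem_edgeSet {a b c d : V} (h : IsFourCycle G a b c d) {e : Sym2 V}
    (he : e ∈ cycleEdges a b c d) : e ∈ G.edgeSet := by
  rcases mem_cycleEdges.1 he with rfl | rfl | rfl | rfl
  exacts [h.ab, h.bc, h.cd, h.da]

/-- For nonadjacent `a` and `c`, the edges `ay` and `cz` are at distance more than two. -/
structure IsFarPair (G : SimpleGraph V) (a c y z : V) : Prop where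
  ay : G.Adj a y
  cz : G.Adj c z
  not_az : ¬ G.Adj a z
  not_cy : ¬ G.Adj c y
  not_yz : ¬ G.Adj y z

lemma IsFourCycle.edgesNear {a b c d : V} (h : IsFourCycle G a b c d) {e f : Sym2 V}
    (he : ∃ x ∈ e, x ∈ ({a, b, c, d} : Finset V)) (hf : f ∈ cycleEdges a b c d) :
    EdgesNear G e f := by
  obtain ⟨x, hxe, hx⟩ := he
  suffices x ∈ f ∨ ∃ y ∈ f, G.Adj x y by
    rcases this with hxf | ⟨y, hy, hxy⟩
    exacts [Or.inl ⟨x, hxe, hxf⟩, Or.inr ⟨x, y, hxe, hy, hxy⟩]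
  obtain ⟨h1, h2, h3, h4, -, -⟩ := h
  have h1' := h1.symm
  have h2' := h2.symm
  have h3' := h3.symm
  have h4' := h4.symm
  simp only [mem_insert, mem_singleton] at hx
  rcases mem_cycleEdges.1 hf with rfl | rfl | rfl | rfl <;>
    rcases hx with rfl | rfl | rfl | rfl <;> simp [*]

section FarPair

variable {a b c d y z : V}

/-- The edges of a far pair. -/
def farPairEdges (a c y z : V) : Finset (Sym2 V) := {s(a, y), s(c, z)}

lemma mem_farPairEdges {e : Sym2 V} : e ∈ farPairEdges a c y z ↔ e = s(a, y) ∨ e = s(c, z) := by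
  simp [farPairEdges]

lemma farPairEdges_touch {e : Sym2 V} (he : e ∈ farPairEdges a c y z) :
    ∃ x ∈ e, x ∈ ({a, b, c, d} : Finset V) := by
  rcases mem_farPairEdges.1 he with rfl | rfl
  exacts [⟨a, by simp⟩, ⟨c, by simp⟩]

lemma IsFarPair.mem_edgeSet (p : IsFarPair G a c y z) {e : Sym2 V}
    (he : e ∈ farPairEdges a c y z) : e ∈ G.edgeSet := by
  rcases mem_farPairEdges.1 he with rfl | rfl
  exacts [p.ay, p.cz]

lemma IsFarPair.ne (p : IsFarPair G a c y z) : y ≠ z := by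
  rintro rfl
  exact p.not_az p.ay

lemma IsFarPair.eq_of_mem (p : IsFarPair G a c y z) (hac : a ≠ c) (hac' : ¬ G.Adj a c)
    {e f : Sym2 V} (he : e ∈ farPairEdges a c y z) (hf : f ∈ farPairEdges a c y z) {x : V}
    (hxe : x ∈ e) (hxf : x ∈ f) : e = f := by
  have h1 : a ≠ z := by rintro rfl; exact hac' p.cz.symm
  have h2 : c ≠ y := by rintro rfl; exact hac' p.ay
  have h3 := p.ne
  rcases mem_farPairEdges.1 he with rfl | rfl <;> rcases mem_farPairEdges.1 hf with rfl | rfl <;>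
    rw [Sym2.mem_iff] at hxe hxf <;> first | rfl | grind

lemma IsFarPair.edge_ne (p : IsFarPair G a c y z) (hac : a ≠ c) (hac' : ¬ G.Adj a c) :
    s(a, y) ≠ s(c, z) := by
  intro h
  rcases Sym2.eq_iff.1 h with h | h
  · exact hac h.1
  · exact hac' (h.1 ▸ p.cz.symm)

lemma IsFarPair.card_farPairEdges (p : IsFarPair G a c y z) (hac : a ≠ c) (hac' : ¬ G.Adj a c) :
    #(farPairEdges a c y z) = 2 := card_pair (p.edge_ne hac hac')

lemma IsFarPair.not_conflictGraph_adj (p : IsFarPair G a c y z) (hac : a ≠ c)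
    (hac' : ¬ G.Adj a c) {e f : Sym2 V} (he : e ∈ farPairEdges a c y z)
    (hf : f ∈ farPairEdges a c y z) : ¬ (conflictGraph G).Adj e f := by
  have key : ¬ (conflictGraph G).Adj s(a, y) s(c, z) := by
    rintro ⟨hne, -, -, ⟨x, hx, hx'⟩ | ⟨x, x', hx, hx', h⟩⟩
    · exact hne (p.eq_of_mem hac hac' (by simp [farPairEdges]) (by simp [farPairEdges]) hx hx')
    · rcases Sym2.mem_iff.1 hx with rfl | rfl <;> rcases Sym2.mem_iff.1 hx' with rfl | rfl
      exacts [hac' h, p.not_az h, p.not_cy h.symm, p.not_yz h]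
  rcases mem_farPairEdges.1 he with rfl | rfl <;> rcases mem_farPairEdges.1 hf with rfl | rfl
  exacts [(conflictGraph G).loopless.irrefl _, key, fun h => key h.symm,
    (conflictGraph G).loopless.irrefl _]

lemma IsFarPair.disjoint_cycleEdges (p : IsFarPair G a c y z) (h : IsFourCycle G a b c d)
    (hac : ¬ G.Adj a c) : Disjoint (farPairEdges a c y z) (cycleEdges a b c d) := by
  have hmem : ∀ e ∈ cycleEdges a b c d, ∀ x ∈ e, x = a ∨ x = b ∨ x = c ∨ x = d := by
    intro e he x hx
    rcases mem_cycleEdges.1 he with rfl | rfl | rfl | rfl <;>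
      rcases Sym2.mem_iff.1 hx with rfl | rfl <;> simp
  refine disjoint_left.2 fun e he he' => ?_
  rcases mem_farPairEdges.1 he with rfl | rfl
  · rcases hmem _ he' y (by simp) with rfl | rfl | rfl | rfl
    exacts [p.ay.ne rfl, p.not_cy h.bc.symm, hac p.ay, p.not_cy h.cd]
  · rcases hmem _ he' z (by simp) with rfl | rfl | rfl | rfl
    exacts [hac p.cz.symm, p.not_az h.ab, p.cz.ne rfl, p.not_az h.da.symm]

end FarPair

/-- Every vertex of `U` has at most one neighbor in `X ⊆ U`. -/
structure IsSparse (G : SimpleGraph V) (U X : Finset V) : Prop where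
  subset : X ⊆ U
  card_le : ∀ x ∈ U, #{y ∈ X | G.Adj x y} ≤ 1

lemma IsSparse.card_le_card_filter {U X S : Finset V} (h : IsSparse G U X) (hS : S ⊆ X) {x : V}
    (hx : x ∈ U) : #S ≤ #{y ∈ S | ¬ G.Adj x y} + 1 := by
  have h1 := card_filter_add_card_filter_not (s := S) (fun y => G.Adj x y)
  have h2 := card_le_card (filter_subset_filter (fun y => G.Adj x y) hS)
  have h3 := h.card_le x hx
  omega

section Transversal

variable {U A B C D E : Finset V}

lemma exists_independent_transversal_of_pair (hA : IsSparse G U A) (hB : IsSparse G U B)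
    (hC : IsSparse G U C) (hD : IsSparse G U D) (hE : IsSparse G U E) (hD4 : #D = 4)
    (hE4 : #E = 4) {x z : V} (hx : x ∈ A) (hz : z ∈ B)
    (h3 : 3 ≤ #{y ∈ C | ¬ G.Adj x y ∧ ¬ G.Adj z y}) :
    ∃ y ∈ C, ∃ p ∈ D, ∃ r ∈ E, ¬ G.Adj x y ∧ ¬ G.Adj x p ∧ ¬ G.Adj x r ∧
      ¬ G.Adj z y ∧ ¬ G.Adj z p ∧ ¬ G.Adj z r ∧ ¬ G.Adj y p ∧ ¬ G.Adj y r ∧ ¬ G.Adj p r := by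
  have hxU := hA.subset hx
  have hzU := hB.subset hz
  have key : ∀ {X : Finset V}, IsSparse G U X → #X = 4 →
      2 ≤ #{y ∈ X | ¬ G.Adj x y ∧ ¬ G.Adj z y} := by
    intro X hX hX4
    rw [← filter_filter]
    have h1 := hX.card_le_card_filter subset_rfl hxU
    have h2 := hX.card_le_card_filter (filter_subset (fun y => ¬ G.Adj x y) X) hzU
    omega
  obtain ⟨p, hp⟩ := card_pos.1 (Nat.lt_of_succ_lt (key hD hD4))
  rw [mem_filter] at hp
  have hpU := hD.subset hp.1
  have h1 := hE.card_le_card_filter (filter_subset (fun y => ¬ G.Adj x y ∧ ¬ G.Adj z y) E) hpU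
  have h2 := key hE hE4
  obtain ⟨r, hr⟩ := card_pos.1 (show 0 < #({y ∈ {y ∈ E | ¬ G.Adj x y ∧ ¬ G.Adj z y} |
    ¬ G.Adj p y}) by omega)
  rw [mem_filter, mem_filter] at hr
  have hrU := hE.subset hr.1.1
  have h4 := hC.card_le_card_filter (filter_subset (fun y => ¬ G.Adj x y ∧ ¬ G.Adj z y) C) hpU
  have h5 := hC.card_le_card_filter ((filter_subset (fun y => ¬ G.Adj p y) _).trans
    (filter_subset (fun y => ¬ G.Adj x y ∧ ¬ G.Adj z y) C)) hrU
  obtain ⟨y, hy⟩ := card_pos.1 (show 0 < #({y ∈ {y ∈ {y ∈ C | ¬ G.Adj x y ∧ ¬ G.Adj z y} |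
    ¬ G.Adj p y} | ¬ G.Adj r y}) by omega)
  simp only [mem_filter] at hy
  exact ⟨y, hy.1.1.1, p, hp.1, r, hr.1.1, hy.1.1.2.1, hp.2.1, hr.1.2.1, hy.1.1.2.2, hp.2.2,
    hr.1.2.2, fun h => hy.1.2 h.symm, fun h => hy.2 h.symm, hr.2⟩

end Transversal

variable [Fintype V]

/-- The number of common neighbors of two vertices. -/
def codegree (G : SimpleGraph V) (a b : V) : ℕ := #(G.neighborFinset a ∩ G.neighborFinset b)

/-- `G` is 5-regular and triangle-free. -/
structure IsFiveRegularTriangleFree (G : SimpleGraph V) : Prop where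
  degree_eq : ∀ v, #(G.neighborFinset v) = 5
  not_adj : ∀ {a b c}, G.Adj a b → G.Adj a c → ¬ G.Adj b c

lemma codegree_comm (a b : V) : codegree G a b = codegree G b a := by
  rw [codegree, inter_comm, ← codegree]

lemma one_le_codegree {a b x : V} (ha : G.Adj a x) (hb : G.Adj b x) : 1 ≤ codegree G a b :=
  card_pos.2 ⟨x, by simp [ha, hb]⟩

lemma two_le_codegree {a b x y : V} (hxy : x ≠ y) (hax : G.Adj a x) (hbx : G.Adj b x)
    (hay : G.Adj a y) (hby : G.Adj b y) : 2 ≤ codegree G a b := by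
  rw [← card_pair hxy]
  refine card_le_card fun z hz => ?_
  rcases mem_insert.1 hz with rfl | hz
  · simp [hax, hbx]
  · rw [mem_singleton] at hz
    simp [hz, hay, hby]

lemma codegree_self (hG : IsFiveRegularTriangleFree G) (a : V) : codegree G a a = 5 := by
  rw [codegree, inter_self, hG.degree_eq]

/-- The number of edges at distance at most two from `ab` is at most `49` minus the number of
edges between the neighborhoods of `a` and `b`. -/
lemma degree_conflictGraph_add_sum_codegree_le (hG : IsFiveRegularTriangleFree G) {a b : V}
    (hab : G.Adj a b) :
    #((conflictGraph G).neighborFinset s(a, b)) +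
      ∑ x ∈ G.neighborFinset a, codegree G x b ≤ 49 := by
  set A := (G.neighborFinset a).biUnion fun x => G.incidenceFinset x with hA
  set B := (G.neighborFinset b).biUnion fun x => G.incidenceFinset x with hB
  have hcard : ∀ v, #((G.neighborFinset v).biUnion fun x => G.incidenceFinset x) ≤ 25 := by
    intro v
    refine (card_biUnion_le_card_mul _ _ 5 fun x _ => ?_).trans ?_
    · rw [card_incidenceFinset_eq_degree, ← card_neighborFinset_eq_degree, hG.degree_eq]
    · rw [hG.degree_eq]
  have hmem : ∀ v f, f ∈ ((G.neighborFinset v).biUnion fun x => G.incidenceFinset x) ↔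
      f ∈ G.edgeSet ∧ ∃ x, G.Adj v x ∧ x ∈ f := by
    intro v f
    simp only [mem_biUnion, mem_neighborFinset, mem_incidenceFinset, incidenceSet, Set.mem_sep_iff]
    tauto
  have hN : (conflictGraph G).neighborFinset s(a, b) ⊆ (A ∪ B).erase s(a, b) := by
    intro f hf
    rw [mem_neighborFinset] at hf
    obtain ⟨h1, -, h3, h4⟩ := hf
    rw [mem_erase, mem_union, hA, hB, hmem, hmem]
    refine ⟨h1.symm, ?_⟩
    rcases h4 with ⟨x, hx, hx'⟩ | ⟨x, y, hx, hy, h⟩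
    · rcases Sym2.mem_iff.1 hx with rfl | rfl
      · exact Or.inr ⟨h3, x, hab.symm, hx'⟩
      · exact Or.inl ⟨h3, x, hab, hx'⟩
    · rcases Sym2.mem_iff.1 hx with rfl | rfl
      · exact Or.inl ⟨h3, y, h, hy⟩
      · exact Or.inr ⟨h3, y, h, hy⟩
  have he : s(a, b) ∈ A ∪ B := by
    rw [mem_union, hA, hmem]
    exact Or.inl ⟨hab, b, hab, by simp⟩
  have hI : ∑ x ∈ G.neighborFinset a, codegree G x b ≤ #(A ∩ B) := by
    unfold codegree
    rw [← card_sigma]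
    refine card_le_card_of_injOn (fun p => s(p.1, p.2)) ?_ ?_
    · rintro ⟨x, y⟩ hp
      simp only [coe_sigma, Set.mem_sigma_iff, coe_inter, Set.mem_inter_iff, mem_coe,
        mem_neighborFinset] at hp
      rw [mem_coe, mem_inter, hA, hB, hmem, hmem]
      exact ⟨⟨hp.2.1, x, hp.1, by simp⟩, ⟨hp.2.1, y, hp.2.2, by simp⟩⟩
    · rintro ⟨x, y⟩ hp ⟨x', y'⟩ hp' h
      simp only [coe_sigma, Set.mem_sigma_iff, coe_inter, Set.mem_inter_iff, mem_coe,
        mem_neighborFinset] at hp hp'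
      rcases Sym2.eq_iff.1 h with ⟨h1, h2⟩ | ⟨h1, h2⟩
      · simp only at h1 h2
        subst h1 h2; rfl
      · simp only at h1 h2
        subst h1 h2
        exact absurd hab.symm (hG.not_adj hp'.2.2.symm hp.1.symm)
  have h1 := card_le_card hN
  rw [card_erase_of_mem he] at h1
  have h2 := card_union_add_card_inter A B
  have h3 : #A ≤ 25 := hcard a
  have h4 : #B ≤ 25 := hcard b
  have h5 := card_pos.2 ⟨_, he⟩
  omega

lemma degree_conflictGraph_le (hG : IsFiveRegularTriangleFree G) {a b : V} (hab : G.Adj a b) :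
    #((conflictGraph G).neighborFinset s(a, b)) ≤ 40 := by
  have h := degree_conflictGraph_add_sum_codegree_le hG hab
  have hb : b ∈ G.neighborFinset a := by simpa using hab
  rw [← add_sum_erase _ _ hb, codegree_self hG] at h
  have : #((G.neighborFinset a).erase b) • 1 ≤
      ∑ x ∈ (G.neighborFinset a).erase b, codegree G x b := by
    refine card_nsmul_le_sum _ _ _ fun x hx => ?_
    have hx' : G.Adj a x := by simpa using mem_of_mem_erase hx
    exact one_le_codegree hx'.symm hab.symm
  rw [card_erase_of_mem hb, hG.degree_eq] at this
  simp only [smul_eq_mul] at this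
  omega

/-- In a 4-cycle `abcd`, the edge `ab` has at most `43 - codeg(a,c) - codeg(b,d)` edges at distance
at most two; a further one is saved for each neighbor of `a` outside the cycle having a third
common neighbor with `b`. -/
lemma degree_conflictGraph_of_cycle (hG : IsFiveRegularTriangleFree G) {a b c d : V}
    (hab : G.Adj a b) (hbc : G.Adj b c) (hcd : G.Adj c d) (hda : G.Adj d a)
    (hac : a ≠ c) (hbd : b ≠ d) :
    #((conflictGraph G).neighborFinset s(a, b)) + codegree G a c + codegree G b d ≤ 43 ∧
    ∀ w, G.Adj a w → G.Adj w c → w ≠ b → w ≠ d → 3 ≤ codegree G w b →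
      #((conflictGraph G).neighborFinset s(a, b)) + codegree G a c + codegree G b d ≤ 42 := by
  have h := degree_conflictGraph_add_sum_codegree_le hG hab
  have hb : b ∈ G.neighborFinset a := by simpa using hab
  have hd : d ∈ (G.neighborFinset a).erase b := by simp [hbd.symm, hda.symm]
  rw [← add_sum_erase _ _ hb, codegree_self hG, ← add_sum_erase _ _ hd,
    codegree_comm d b] at h
  set R := ((G.neighborFinset a).erase b).erase d with hR
  have hRa : ∀ x ∈ R, G.Adj a x ∧ x ≠ b ∧ x ≠ d := by
    intro x hx
    simp only [hR, mem_erase, mem_neighborFinset] at hx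
    tauto
  have hRc : #R = 3 := by
    rw [hR, card_erase_of_mem hd, card_erase_of_mem hb, hG.degree_eq]
  have hle : ∀ x ∈ R, (1 + if G.Adj x c then 1 else 0) ≤ codegree G x b := by
    intro x hx
    have hx := hRa x hx
    split_ifs with hxc
    · exact two_le_codegree hac hx.1.symm hab.symm hxc hbc
    · exact one_le_codegree hx.1.symm hab.symm
  have hsum : ∑ x ∈ R, (1 + if G.Adj x c then 1 else 0) = 1 + codegree G a c := by
    rw [sum_add_distrib, sum_const, hRc, ← card_filter]
    have : G.neighborFinset a ∩ G.neighborFinset c =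
        insert b (insert d {x ∈ R | G.Adj x c}) := by
      ext x
      simp only [mem_inter, mem_neighborFinset, mem_insert, mem_filter, hR, mem_erase]
      constructor
      · rintro ⟨h1, h2⟩
        have := h2.symm
        tauto
      · rintro (rfl | rfl | h)
        · exact ⟨hab, hbc.symm⟩
        · exact ⟨hda.symm, hcd⟩
        · exact ⟨h.1.2.2, h.2.symm⟩
    rw [codegree, this, card_insert_of_notMem, card_insert_of_notMem]
    · simp only [smul_eq_mul]; omega
    · simp [hR]
    · simp [hR, hbd]
  refine ⟨?_, fun w haw hwc hwb hwd hw => ?_⟩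
  · have := sum_le_sum hle
    omega
  · have hwR : w ∈ R := by simp [hR, haw, hwb, hwd]
    have := sum_lt_sum hle ⟨w, hwR, by rw [if_pos hwc]; omega⟩
    omega

/-- The edges in the connected component of `v`. -/
def componentEdges (G : SimpleGraph V) (v : V) : Finset (Sym2 V) :=
  {e | e ∈ G.edgeSet ∧ ∃ x ∈ e, G.Reachable v x}

/-- The connected component of `v` has a strong edge-coloring with 37 colors. -/
def ComponentColorable (G : SimpleGraph V) (v : V) : Prop :=
  ∃ c, ProperOn (conflictGraph G) (componentEdges G v) c

lemma ComponentColorable.of_reachable {u v : V} (h : ComponentColorable G u)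
    (huv : G.Reachable u v) : ComponentColorable G v := by
  obtain ⟨c, hc⟩ := h
  have : componentEdges G v = componentEdges G u := by
    ext e
    simp only [componentEdges, mem_filter, mem_univ, true_and]
    refine and_congr_right fun _ => exists_congr fun x => and_congr_right fun _ => ?_
    exact ⟨huv.trans, huv.symm.trans⟩
  exact ⟨c, this ▸ hc⟩

lemma ComponentColorable.of_adj {u v : V} (h : ComponentColorable G u) (huv : G.Adj u v) :
    ComponentColorable G v := h.of_reachable huv.reachable

lemma ProperOn.mono {E : Type*} {K : SimpleGraph E} {S S' : Finset E} {c : E → Fin 37}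
    (h : ProperOn K S c) (hS : S' ⊆ S) : ProperOn K S' c :=
  fun e he f hf => h e (hS he) f (hS hf)

/-- If the precolored edges form a matching, then all edges of the component of `v` avoiding a set
`B` that contains `v` can be colored greedily, in order of decreasing distance to `v`. -/
lemma exists_extension_avoiding (hG : IsFiveRegularTriangleFree G) {v : V} {B : Finset V}
    (hv : v ∈ B) {M : Finset (Sym2 V)} {c : Sym2 V → Fin 37}
    (hc : ProperOn (conflictGraph G) M c)
    (hM : ∀ e ∈ M, ∀ f ∈ M, ∀ x, x ∈ e → x ∈ f → e = f) :
    ∃ c', ProperOn (conflictGraph G) (M ∪ {e ∈ componentEdges G v | ∀ x ∈ e, x ∉ B}) c' ∧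
      ∀ e ∈ M, c' e = c e := by
  let ρ : Sym2 V → ℕ := fun e => sInf (G.dist v '' {x | x ∈ e})
  have hρ : ∀ e, ∀ x ∈ e, ρ e ≤ G.dist v x := fun e x hx => Nat.sInf_le ⟨x, hx, rfl⟩
  refine exists_greedy_extension ρ hc _ fun e he => ?_
  simp only [componentEdges, mem_filter, mem_univ, true_and] at he
  obtain ⟨⟨heG, y, hye, hvy⟩, heB⟩ := he
  have hdeg : demand (conflictGraph G) M c e ≤ 40 := by
    induction e with
    | _ a b => exact (demand_le_degree _ _ _).trans (degree_conflictGraph_le hG heG)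
  obtain ⟨a, hae, ha⟩ : ρ e ∈ G.dist v '' {x | x ∈ e} := Nat.sInf_mem ⟨_, y, hye, rfl⟩
  have hae : a ∈ e := hae
  have hya : G.Reachable y a := by
    induction e with
    | _ p q =>
      have hpq : G.Adj p q := heG
      rcases Sym2.mem_iff.1 hye with rfl | rfl <;> rcases Sym2.mem_iff.1 hae with rfl | rfl
      exacts [.refl _, hpq.reachable, hpq.symm.reachable, .refl _]
  have hva := hvy.trans hya
  have hne : v ≠ a := fun h => heB a hae (h ▸ hv)
  obtain ⟨x, hxa, hx⟩ : ∃ x, G.Adj x a ∧ G.dist v x < G.dist v a := by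
    obtain ⟨p, hp⟩ := hva.symm.exists_walk_length_eq_dist
    cases p with
    | nil => exact absurd rfl hne
    | cons h p =>
      rename_i x
      refine ⟨x, h.symm, ?_⟩
      rw [dist_comm, dist_comm (v := a), ← hp, Walk.length_cons]
      exact Nat.lt_succ_of_le (dist_le p)
  have hxe : x ∉ e := fun h => by
    have := hρ e x h
    omega
  have hsub : G.incidenceFinset x \ M ⊆ {f ∈ (conflictGraph G).neighborFinset e \ M |
      f ∉ ({e ∈ componentEdges G v | ∀ x ∈ e, x ∉ B} : Finset _) ∨ ρ f < ρ e} := by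
    intro f hf
    rw [mem_sdiff, mem_incidenceFinset] at hf
    obtain ⟨⟨hfG, hxf⟩, hfM⟩ := hf
    rw [mem_filter, mem_sdiff, mem_neighborFinset]
    refine ⟨⟨⟨fun h => hxe (h ▸ hxf), heG, hfG, Or.inr ⟨a, x, hae, hxf, hxa.symm⟩⟩, hfM⟩,
      Or.inr ?_⟩
    have := hρ f x hxf
    omega
  have h1 := card_le_card hsub
  have h2 := card_sdiff_add_card_inter (G.incidenceFinset x) M
  have h3 : #(G.incidenceFinset x ∩ M) ≤ 1 := by
    refine card_le_one.2 fun f hf g hg => ?_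
    simp only [mem_inter, mem_incidenceFinset] at hf hg
    exact hM f hf.2 g hg.2 x hf.1.2 hg.1.2
  rw [card_incidenceFinset_eq_degree, ← card_neighborFinset_eq_degree, hG.degree_eq] at h2
  omega

/-- If the edges at `v` have demand at most 36 for a matching of precolored edges, then the
component of `v` is colorable. -/
lemma componentColorable_of_star (hG : IsFiveRegularTriangleFree G) {v : V}
    {M : Finset (Sym2 V)} {c : Sym2 V → Fin 37} (hc : ProperOn (conflictGraph G) M c)
    (hM : ∀ e ∈ M, ∀ f ∈ M, ∀ x, x ∈ e → x ∈ f → e = f)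
    (hd : ∀ w, G.Adj v w → demand (conflictGraph G) M c s(v, w) ≤ 36) :
    ComponentColorable G v := by
  obtain ⟨c₁, hc₁, h₁⟩ := exists_extension_avoiding hG (mem_singleton_self v) hc hM
  obtain ⟨c₂, hc₂, -⟩ := exists_greedy_extension (fun _ => 0) hc₁ (G.incidenceFinset v) (by
    intro e he
    rw [mem_incidenceFinset] at he
    obtain ⟨heG, hve⟩ := he
    obtain ⟨w, rfl⟩ := hve
    exact ((demand_mono subset_union_left h₁ _).trans (hd w heG)).trans (Nat.le_add_right _ _))
  refine ⟨c₂, hc₂.mono fun e he => ?_⟩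
  by_cases hve : v ∈ e
  · refine mem_union_right _ ?_
    simp only [componentEdges, mem_filter, mem_univ, true_and] at he
    rw [mem_incidenceFinset]
    exact ⟨he.1, hve⟩
  · refine mem_union_left _ (mem_union_right _ (mem_filter.2 ⟨he, ?_⟩))
    intro x hx hxv
    rw [mem_singleton] at hxv
    exact hve (hxv ▸ hx)

/-- If all edges of the component avoiding the 4-cycle `abcd` are colored, every edge of the
cycle has demand at most 37 and one of them at most 36, then the coloring can be completed. -/
lemma IsFourCycle.componentColorable_of_extension (hG : IsFiveRegularTriangleFree G) {a b c d : V}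
    (h : IsFourCycle G a b c d) {S : Finset (Sym2 V)} {χ : Sym2 V → Fin 37}
    (hχ : ProperOn (conflictGraph G) S χ) (hS : Disjoint S (cycleEdges a b c d))
    (hout : ∀ e ∈ componentEdges G a, (∀ x ∈ e, x ∉ ({a, b, c, d} : Finset V)) → e ∈ S)
    (h37 : ∀ f ∈ cycleEdges a b c d, demand (conflictGraph G) S χ f ≤ 37)
    (h36 : ∃ f ∈ cycleEdges a b c d, demand (conflictGraph G) S χ f ≤ 36) :
    ComponentColorable G a := by
  obtain ⟨f₀, hf₀, hd₀⟩ := h36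
  have hCS : ∀ f ∈ cycleEdges a b c d, f ∉ S := fun f hf hfS => (disjoint_left.1 hS) hfS hf
  have hvert : ∀ f ∈ cycleEdges a b c d, ∃ x ∈ f, x ∈ ({a, b, c, d} : Finset V) := by
    intro f hf
    rcases mem_cycleEdges.1 hf with rfl | rfl | rfl | rfl
    exacts [⟨a, by simp⟩, ⟨b, by simp⟩, ⟨c, by simp⟩, ⟨d, by simp⟩]
  let ρ : Sym2 V → ℕ := fun e => if e = f₀ then 0 else if e ∈ cycleEdges a b c d then 1 else 2
  obtain ⟨χ', hχ', -⟩ := exists_greedy_extension ρ hχ (componentEdges G a \ S) (by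
    intro e he
    rw [mem_sdiff] at he
    have heG : e ∈ G.edgeSet := (mem_filter.1 he.1).2.1
    by_cases heC : e ∈ cycleEdges a b c d
    · by_cases hef : e = f₀
      · subst hef
        omega
      · have hmem : f₀ ∈ {f ∈ (conflictGraph G).neighborFinset e \ S |
            f ∉ componentEdges G a \ S ∨ ρ f < ρ e} := by
          rw [mem_filter, mem_sdiff, mem_neighborFinset]
          refine ⟨⟨⟨hef, heG, h.mem_edgeSet hf₀, h.edgesNear (hvert e heC) hf₀⟩, hCS _ hf₀⟩,
            Or.inr ?_⟩
          simp [ρ, hef, heC]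
        have := card_pos.2 ⟨_, hmem⟩
        have := h37 e heC
        omega
    · have hsub : cycleEdges a b c d ⊆ {f ∈ (conflictGraph G).neighborFinset e \ S |
            f ∉ componentEdges G a \ S ∨ ρ f < ρ e} := by
        intro f hf
        have hne : e ≠ f := fun hef => heC (hef ▸ hf)
        rw [mem_filter, mem_sdiff, mem_neighborFinset]
        refine ⟨⟨⟨hne, heG, h.mem_edgeSet hf, h.edgesNear ?_ hf⟩, hCS _ hf⟩, Or.inr ?_⟩
        · by_contra! hcon
          exact he.2 (hout e he.1 hcon)
        · have hef : e ≠ f₀ := fun hef => heC (hef ▸ hf₀)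
          simp only [ρ, hef, heC, hf, if_false, if_true]
          split_ifs <;> omega
      have h1 := card_le_card hsub
      rw [h.card_cycleEdges] at h1
      have hdeg : demand (conflictGraph G) S χ e ≤ 40 := by
        induction e with
        | _ p q => exact (demand_le_degree _ _ _).trans (degree_conflictGraph_le hG heG)
      omega)
  refine ⟨χ', hχ'.mono fun e he => ?_⟩
  by_cases heS : e ∈ S <;> simp [heS, he]

lemma IsFourCycle.componentColorable_of_demand (hG : IsFiveRegularTriangleFree G) {a b c d : V}
    (h : IsFourCycle G a b c d) {M : Finset (Sym2 V)} {χ : Sym2 V → Fin 37}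
    (hχ : ProperOn (conflictGraph G) M χ)
    (hM : ∀ e ∈ M, ∀ f ∈ M, ∀ x, x ∈ e → x ∈ f → e = f)
    (hMC : Disjoint M (cycleEdges a b c d))
    (h37 : ∀ f ∈ cycleEdges a b c d, demand (conflictGraph G) M χ f ≤ 37)
    (h36 : ∃ f ∈ cycleEdges a b c d, demand (conflictGraph G) M χ f ≤ 36) :
    ComponentColorable G a := by
  obtain ⟨χ₁, hχ₁, h₁⟩ := exists_extension_avoiding hG (v := a) (B := {a, b, c, d})
    (by simp) hχ hM
  have hmono := demand_mono (K := conflictGraph G) (subset_union_left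
    (s₂ := {e ∈ componentEdges G a | ∀ x ∈ e, x ∉ ({a, b, c, d} : Finset V)})) h₁
  refine h.componentColorable_of_extension hG hχ₁ ?_
    (fun e he hx => mem_union_right _ (mem_filter.2 ⟨he, hx⟩))
    (fun f hf => (hmono f).trans (h37 f hf)) ?_
  · rw [disjoint_union_left]
    refine ⟨hMC, disjoint_left.2 fun e he heC => ?_⟩
    have := (mem_filter.1 he).2
    rcases mem_cycleEdges.1 heC with rfl | rfl | rfl | rfl
    exacts [this a (by simp) (by simp), this b (by simp) (by simp), this c (by simp) (by simp),
      this d (by simp) (by simp)]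
  · obtain ⟨f, hf, hf'⟩ := h36
    exact ⟨f, hf, (hmono f).trans hf'⟩

lemma IsFourCycle.not_adj (hG : IsFiveRegularTriangleFree G) {a b c d : V}
    (h : IsFourCycle G a b c d) : ¬ G.Adj a c := hG.not_adj h.ab.symm h.bc

/-- If every edge of the 4-cycle `abcd` has demand at most 37, and `ay`, `cz` are uncolored edges at
distance more than two, then the component is colorable: either `ay` and `cz` can get a common
color, or one of them can get a color already seen by `ab`. -/
lemma IsFourCycle.componentColorable_of_farPair (hG : IsFiveRegularTriangleFree G) {a b c d y z : V}
    (h : IsFourCycle G a b c d) {M : Finset (Sym2 V)} {χ : Sym2 V → Fin 37}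
    (hχ : ProperOn (conflictGraph G) M χ)
    (hM : ∀ e ∈ M, ∀ f ∈ M, ∀ x, x ∈ e → x ∈ f → e = f)
    (hMC : Disjoint M (cycleEdges a b c d))
    (h37 : ∀ f ∈ cycleEdges a b c d, demand (conflictGraph G) M χ f ≤ 37)
    (hyz : IsFarPair G a c y z) (hyM : s(a, y) ∉ M) (hzM : s(c, z) ∉ M) :
    ComponentColorable G a := by
  obtain ⟨χ₁, hχ₁, h₁⟩ := exists_extension_avoiding hG (v := a) (B := {a, b, c, d})
    (by simp) hχ hM
  set S := M ∪ {e ∈ componentEdges G a | ∀ x ∈ e, x ∉ ({a, b, c, d} : Finset V)} with hS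
  have hmono := demand_mono (K := conflictGraph G) (show M ⊆ S from subset_union_left) h₁
  have hnotS : ∀ e, e ∉ M → ∀ x ∈ ({a, b, c, d} : Finset V), x ∈ e → e ∉ S := by
    intro e heM x hx hxe heS
    rcases mem_union.1 heS with heS | heS
    · exact heM heS
    · exact (mem_filter.1 heS).2 x hxe hx
  have hSC : ∀ f ∈ cycleEdges a b c d, f ∉ S := by
    intro f hf
    have hfM : f ∉ M := fun h' => (disjoint_left.1 hMC) h' hf
    rcases mem_cycleEdges.1 hf with rfl | rfl | rfl | rfl
    exacts [hnotS _ hfM a (by simp) (by simp), hnotS _ hfM b (by simp) (by simp),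
      hnotS _ hfM c (by simp) (by simp), hnotS _ hfM d (by simp) (by simp)]
  have hout : ∀ e ∈ componentEdges G a, (∀ x ∈ e, x ∉ ({a, b, c, d} : Finset V)) → e ∈ S :=
    fun e he hx => mem_union_right _ (mem_filter.2 ⟨he, hx⟩)
  have habC : s(a, b) ∈ cycleEdges a b c d := by simp [cycleEdges]
  by_cases h36 : demand (conflictGraph G) S χ₁ s(a, b) ≤ 36
  · exact h.componentColorable_of_extension hG hχ₁
      (disjoint_left.2 fun e he heC => hSC e heC he) hout
      (fun f hf => (hmono f).trans (h37 f hf)) ⟨_, habC, h36⟩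
  have hac := h.not_adj hG
  have hyb : y ≠ b := by rintro rfl; exact hyz.not_cy h.bc.symm
  have hyd : y ≠ d := by rintro rfl; exact hyz.not_cy h.cd
  have hzb : z ≠ b := by rintro rfl; exact hyz.not_az h.ab
  have hzd : z ≠ d := by rintro rfl; exact hyz.not_az h.da.symm
  have hyc : y ≠ c := by rintro rfl; exact hac hyz.ay
  have hza : z ≠ a := by rintro rfl; exact hac hyz.cz.symm
  have hMC' := hyz.disjoint_cycleEdges h hac
  have hpS : s(a, y) ∉ S := hnotS _ hyM a (by simp) (by simp)
  have hqS : s(c, z) ∉ S := hnotS _ hzM c (by simp) (by simp)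
  have hpq := hyz.edge_ne h.ac hac
  have hpF : s(a, y) ∈ farPairEdges a c y z := by simp [farPairEdges]
  have hqF : s(c, z) ∈ farPairEdges a c y z := by simp [farPairEdges]
  have hadj := hyz.not_conflictGraph_adj h.ac hac hpF hqF
  have hnear : ∀ e ∈ farPairEdges a c y z, (conflictGraph G).Adj s(a, b) e := fun e he =>
    SimpleGraph.Adj.symm ⟨fun h' => disjoint_left.1 hMC' he (h' ▸ habC), hyz.mem_edgeSet he, h.ab,
      h.edgesNear (farPairEdges_touch he) habC⟩
  have hunion : insert s(a, b) ((conflictGraph G).neighborFinset s(a, b) \ S) ⊆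
      ((conflictGraph G).neighborFinset s(a, y) \ S ∪
        (conflictGraph G).neighborFinset s(c, z) \ S) ∪ {s(a, y), s(c, z)} := by
    intro e he
    have heG : e ∈ G.edgeSet ∧ e ∉ S ∧ ∃ x ∈ e, x ∈ ({a, b, c, d} : Finset V) := by
      rcases mem_insert.1 he with rfl | he
      · exact ⟨h.ab, hSC _ habC, a, by simp⟩
      · rw [mem_sdiff, mem_neighborFinset] at he
        obtain ⟨⟨-, -, heG, hnear⟩, heS⟩ := he
        refine ⟨heG, heS, ?_⟩
        by_contra! hcon
        refine heS (hout e ?_ hcon)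
        simp only [componentEdges, mem_filter, mem_univ, true_and]
        refine ⟨heG, ?_⟩
        have hreach : ∀ x ∈ s(a, b), G.Reachable a x := by
          intro x hx
          rcases Sym2.mem_iff.1 hx with rfl | rfl
          exacts [.refl _, h.ab.reachable]
        rcases hnear with ⟨x, hx, hx'⟩ | ⟨x, y, hx, hy, hxy⟩
        · exact ⟨x, hx', hreach x hx⟩
        · exact ⟨y, hy, (hreach x hx).trans hxy.reachable⟩
    obtain ⟨heG, heS, x, hxe, hx⟩ := heG
    simp only [mem_union, mem_sdiff, heS, not_false_eq_true, and_true, mem_insert, mem_singleton,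
      mem_neighborFinset]
    by_cases hep : e = s(a, y)
    · exact Or.inr (Or.inl hep)
    by_cases heq : e = s(c, z)
    · exact Or.inr (Or.inr heq)
    left
    have key : ∀ {u w}, G.Adj u w → (u = x ∨ G.Adj u x) → e ≠ s(u, w) →
        (conflictGraph G).Adj s(u, w) e := by
      rintro u w huw (rfl | hux) hne
      · exact ⟨hne.symm, huw, heG, Or.inl ⟨u, by simp, hxe⟩⟩
      · exact ⟨hne.symm, huw, heG, Or.inr ⟨u, x, by simp, hxe, hux⟩⟩
    simp only [mem_insert, mem_singleton] at hx
    rcases hx with rfl | rfl | rfl | rfl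
    · exact Or.inl (key hyz.ay (Or.inl rfl) hep)
    · exact Or.inl (key hyz.ay (Or.inr h.ab) hep)
    · exact Or.inr (key hyz.cz (Or.inl rfl) heq)
    · exact Or.inl (key hyz.ay (Or.inr h.da.symm) hep)
  have hinter : (G.incidenceFinset b ∪ G.incidenceFinset d) \ M ⊆
      ((conflictGraph G).neighborFinset s(a, y) \ S) ∩
        ((conflictGraph G).neighborFinset s(c, z) \ S) := by
    intro e he
    rw [mem_sdiff, mem_union, mem_incidenceFinset, mem_incidenceFinset] at he
    obtain ⟨he, heM⟩ := he
    obtain ⟨x, hxe, hax, hcx, hxa, hxy, hxc, hxz, hxC, heG⟩ : ∃ x ∈ e, G.Adj a x ∧ G.Adj c x ∧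
        x ≠ a ∧ x ≠ y ∧ x ≠ c ∧ x ≠ z ∧ x ∈ ({a, b, c, d} : Finset V) ∧ e ∈ G.edgeSet := by
      rcases he with he | he
      · exact ⟨b, he.2, h.ab, h.bc.symm, h.ab.ne', hyb.symm, h.bc.ne, hzb.symm, by simp, he.1⟩
      · exact ⟨d, he.2, h.da.symm, h.cd, h.da.ne, hyd.symm, h.cd.ne', hzd.symm, by simp, he.1⟩
    have heS := hnotS e heM x hxC hxe
    simp only [mem_inter, mem_sdiff, heS, not_false_eq_true, and_true, mem_neighborFinset]
    refine ⟨⟨?_, hyz.ay, heG, Or.inr ⟨a, x, by simp, hxe, hax⟩⟩,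
      ⟨?_, hyz.cz, heG, Or.inr ⟨c, x, by simp, hxe, hcx⟩⟩⟩
    · rintro rfl
      rcases Sym2.mem_iff.1 hxe with h | h <;> contradiction
    · rintro rfl
      rcases Sym2.mem_iff.1 hxe with h | h <;> contradiction
  have hcardI : 8 ≤ #((G.incidenceFinset b ∪ G.incidenceFinset d) \ M) := by
    have hinc : ∀ v, #(G.incidenceFinset v) = 5 := fun v => by
      rw [card_incidenceFinset_eq_degree, ← card_neighborFinset_eq_degree, hG.degree_eq]
    have hdisj : Disjoint (G.incidenceFinset b) (G.incidenceFinset d) := by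
      refine disjoint_left.2 fun e hb hd => ?_
      rw [mem_incidenceFinset] at hb hd
      have := (Sym2.mem_and_mem_iff h.bd).1 ⟨hb.2, hd.2⟩
      subst this
      exact h.rotate.not_adj hG hb.1
    have hle : ∀ v, #(G.incidenceFinset v ∩ M) ≤ 1 := by
      refine fun v => card_le_one.2 fun f hf g hg => ?_
      simp only [mem_inter, mem_incidenceFinset] at hf hg
      exact hM f hf.2 g hg.2 v hf.1.2 hg.1.2
    have h1 := card_union_of_disjoint hdisj
    have h2 := card_sdiff_add_card_inter (G.incidenceFinset b ∪ G.incidenceFinset d) M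
    rw [union_inter_distrib_right] at h2
    have h3 := card_union_le (G.incidenceFinset b ∩ M) (G.incidenceFinset d ∩ M)
    have h4 := hle b
    have h5 := hle d
    have h6 := hinc b
    have h7 := hinc d
    omega
  have hcard : #(((conflictGraph G).neighborFinset s(a, y) ∩ S).image χ₁) +
      #(((conflictGraph G).neighborFinset s(c, z) ∩ S).image χ₁) <
      37 + #(((conflictGraph G).neighborFinset s(a, b) ∩ S).image χ₁) := by
    have h1 := card_le_card hunion
    rw [card_insert_of_notMem (by simp)] at h1
    have h2 := card_union_le ((conflictGraph G).neighborFinset s(a, y) \ S ∪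
      (conflictGraph G).neighborFinset s(c, z) \ S) {s(a, y), s(c, z)}
    have h3 := card_le_two (a := s(a, y)) (b := s(c, z))
    have h4 := card_le_card hinter
    have h5 := card_union_add_card_inter ((conflictGraph G).neighborFinset s(a, y) \ S)
      ((conflictGraph G).neighborFinset s(c, z) \ S)
    have h6 : demand (conflictGraph G) S χ₁ s(a, y) ≤ 40 :=
      (demand_le_degree _ _ _).trans (degree_conflictGraph_le hG hyz.ay)
    have h7 : demand (conflictGraph G) S χ₁ s(c, z) ≤ 40 :=
      (demand_le_degree _ _ _).trans (degree_conflictGraph_le hG hyz.cz)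
    unfold demand at h6 h7 h36
    omega
  obtain ⟨S', χ', hSS', hS', hχ', hχS, hlt⟩ :=
    exists_extension_demand_lt hχ₁ hpS hqS hpq hadj (hnear _ hpF) (hnear _ hqF) hcard
  have hmono' := demand_mono (K := conflictGraph G) hSS' hχS
  refine h.componentColorable_of_extension hG hχ' (disjoint_left.2 fun e he heC => ?_)
    (fun e he hx => hSS' (hout e he hx))
    (fun f hf => ((hmono' f).trans (hmono f)).trans (h37 f hf))
    ⟨_, habC, ?_⟩
  · rcases mem_insert.1 (hS' he) with rfl | he
    · exact disjoint_left.1 hMC' hpF heC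
    · rcases mem_insert.1 he with rfl | he
      · exact disjoint_left.1 hMC' hqF heC
      · exact hSC e heC he
  · have := (hmono s(a, b)).trans (h37 _ habC)
    omega

lemma not_componentColorable_of_adj {u v : V} (h : ¬ ComponentColorable G u) (huv : G.Adj u v) :
    ¬ ComponentColorable G v := fun h' => h (h'.of_adj huv.symm)

lemma IsFourCycle.degree_conflictGraph_le (hG : IsFiveRegularTriangleFree G) {a b c d : V}
    (h : IsFourCycle G a b c d) {f : Sym2 V} (hf : f ∈ cycleEdges a b c d) :
    #((conflictGraph G).neighborFinset f) + codegree G a c + codegree G b d ≤ 43 := by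
  have key : ∀ {a b c d : V}, IsFourCycle G a b c d →
      #((conflictGraph G).neighborFinset s(a, b)) + codegree G a c + codegree G b d ≤ 43 :=
    fun h => (degree_conflictGraph_of_cycle hG h.ab h.bc h.cd h.da h.ac h.bd).1
  have h1 := key h
  have h2 := key h.rotate
  have h3 := key h.rotate.rotate
  have h4 := key h.rotate.rotate.rotate
  rw [codegree_comm d b] at *
  rw [codegree_comm c a] at *
  rcases mem_cycleEdges.1 hf with rfl | rfl | rfl | rfl <;> omega

/-- Each pair of precolored edges of the same color lowers the demand of the cycle edges. -/
lemma IsFourCycle.demand_add_card_le (hG : IsFiveRegularTriangleFree G) {a b c d : V}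
    (h : IsFourCycle G a b c d) {M : Finset (Sym2 V)} (χ : Sym2 V → Fin 37)
    (hMG : ∀ e ∈ M, e ∈ G.edgeSet ∧ ∃ x ∈ e, x ∈ ({a, b, c, d} : Finset V))
    (hMC : Disjoint M (cycleEdges a b c d)) {f : Sym2 V} (hf : f ∈ cycleEdges a b c d) :
    demand (conflictGraph G) M χ f + #M + codegree G a c + codegree G b d ≤
      43 + #(M.image χ) := by
  have hM : M ⊆ (conflictGraph G).neighborFinset f := fun e he => by
    rw [mem_neighborFinset]
    refine SimpleGraph.Adj.symm ⟨?_, (hMG e he).1, h.mem_edgeSet hf, h.edgesNear (hMG e he).2 hf⟩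
    rintro rfl
    exact disjoint_left.1 hMC he hf
  have h1 := _root_.demand_add_card_le (c := χ) hM
  have h2 := h.degree_conflictGraph_le hG hf
  omega

lemma IsFourCycle.componentColorable_of_card (hG : IsFiveRegularTriangleFree G) {a b c d : V}
    (h : IsFourCycle G a b c d) {M : Finset (Sym2 V)} {χ : Sym2 V → Fin 37}
    (hχ : ProperOn (conflictGraph G) M χ)
    (hM : ∀ e ∈ M, ∀ f ∈ M, ∀ x, x ∈ e → x ∈ f → e = f)
    (hMG : ∀ e ∈ M, e ∈ G.edgeSet ∧ ∃ x ∈ e, x ∈ ({a, b, c, d} : Finset V))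
    (hMC : Disjoint M (cycleEdges a b c d))
    (hcard : 7 + #(M.image χ) ≤ #M + codegree G a c + codegree G b d) :
    ComponentColorable G a := by
  have hd : ∀ f ∈ cycleEdges a b c d, demand (conflictGraph G) M χ f ≤ 36 := fun f hf => by
    have := h.demand_add_card_le hG χ hMG hMC hf
    omega
  exact h.componentColorable_of_demand hG hχ hM hMC (fun f hf => (hd f hf).trans (by simp))
    ⟨s(a, b), by simp [cycleEdges], hd _ (by simp [cycleEdges])⟩

lemma IsFourCycle.codegree_add_codegree_le_six (hG : IsFiveRegularTriangleFree G) {a b c d : V}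
    (h : IsFourCycle G a b c d) (ha : ¬ ComponentColorable G a) :
    codegree G a c + codegree G b d ≤ 6 := by
  by_contra! hlt
  exact ha (h.componentColorable_of_card hG (M := ∅) (χ := fun _ => 0) (by simp [ProperOn])
    (by simp) (by simp) (by simp) (by simp; omega))

section FarPair

variable {a b c d y z : V}

/-- A far pair can be colored with a single color. -/
lemma IsFourCycle.componentColorable_of_six_le (hG : IsFiveRegularTriangleFree G)
    (h : IsFourCycle G a b c d) (p : IsFarPair G a c y z)
    (h6 : 6 ≤ codegree G a c + codegree G b d) : ComponentColorable G a := by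
  have hac := h.not_adj hG
  refine h.componentColorable_of_card hG (M := farPairEdges a c y z) (χ := fun _ => 0)
    (fun e he f hf hef => absurd hef (p.not_conflictGraph_adj h.ac hac he hf))
    (fun e he f hf x hxe hxf => p.eq_of_mem h.ac hac he hf hxe hxf)
    (fun e he => ⟨p.mem_edgeSet he, farPairEdges_touch he⟩) (p.disjoint_cycleEdges h hac) ?_
  have h1 := p.card_farPairEdges h.ac hac
  have h2 : #((farPairEdges a c y z).image fun _ => (0 : Fin 37)) ≤ 1 :=
    card_le_one.2 (by simp)
  omega

lemma IsFourCycle.componentColorable_of_five_le (hG : IsFiveRegularTriangleFree G) {y' z' : V}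
    (h : IsFourCycle G a b c d) (p : IsFarPair G a c y z) (p' : IsFarPair G a c y' z')
    (hy : y ≠ y') (hz : z ≠ z') (h5 : 5 ≤ codegree G a c + codegree G b d) :
    ComponentColorable G a := by
  have hac := h.not_adj hG
  refine h.componentColorable_of_farPair hG (M := farPairEdges a c y z) (χ := fun _ => 0)
    (fun e he f hf hef => absurd hef (p.not_conflictGraph_adj h.ac hac he hf))
    (fun e he f hf x hxe hxf => p.eq_of_mem h.ac hac he hf hxe hxf)
    (p.disjoint_cycleEdges h hac) (fun f hf => ?_) p' (fun hm => ?_) (fun hm => ?_)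
  · have h1 := p.card_farPairEdges h.ac hac
    have h2 : #((farPairEdges a c y z).image fun _ => (0 : Fin 37)) ≤ 1 :=
      card_le_one.2 (by simp)
    have h3 := h.demand_add_card_le hG (fun _ => 0)
      (fun e he => ⟨p.mem_edgeSet he, farPairEdges_touch he⟩) (p.disjoint_cycleEdges h hac) hf
    omega
  · have := p.eq_of_mem h.ac hac hm (mem_farPairEdges.2 (.inl rfl)) (x := a) (by simp) (by simp)
    exact hy (Sym2.congr_right.1 this).symm
  · have := p.eq_of_mem h.ac hac hm (mem_farPairEdges.2 (.inr rfl)) (x := c) (by simp) (by simp)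
    exact hz (Sym2.congr_right.1 this).symm

end FarPair

/-- Either there are two disjoint nonadjacent pairs between `A` and `B`, or up to one vertex
on one of the sides, `A` and `B` are completely joined. -/
lemma exists_disjoint_not_adj {A B : Finset V} (hA : A.Nonempty) :
    (∃ y ∈ A, ∃ y' ∈ A, ∃ z ∈ B, ∃ z' ∈ B, y ≠ y' ∧ z ≠ z' ∧ ¬ G.Adj y z ∧ ¬ G.Adj y' z') ∨
      (∃ y₀, ∀ y ∈ A.erase y₀, ∀ z ∈ B, G.Adj y z) ∨
      ∃ z₀, ∀ z ∈ B.erase z₀, ∀ y ∈ A, G.Adj y z := by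
  by_contra! hcon
  obtain ⟨h1, h2, h3⟩ := hcon
  simp only [mem_erase] at h2 h3
  obtain ⟨v, hv⟩ := hA
  obtain ⟨y, ⟨-, hy⟩, z, hz, hyz⟩ := h2 v
  obtain ⟨y', ⟨hne, hy'⟩, z', hz', hyz'⟩ := h2 y
  obtain ⟨z'', ⟨hne', hz''⟩, y'', hy'', hyz''⟩ := h3 z
  grind

lemma three_le_card_sdiff (hG : IsFiveRegularTriangleFree G) {a c : V} {n : ℕ}
    (h : codegree G a c + n ≤ 5) : n ≤ #(G.neighborFinset a \ G.neighborFinset c) := by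
  have := card_inter_add_card_sdiff (G.neighborFinset a) (G.neighborFinset c)
  rw [hG.degree_eq] at this
  unfold codegree at h
  omega

/-- If `y`, `y'` are neighbors of `a` and `B` is a set of common neighbors of `y` and `y'`
avoiding `a`, then the codegree of `y` and `y'` is more than `#B`. -/
lemma card_lt_codegree {a y y' : V} {B : Finset V} (hy : G.Adj a y) (hy' : G.Adj a y')
    (haB : a ∉ B) (hB : ∀ z ∈ B, G.Adj y z ∧ G.Adj y' z) : #B < codegree G y y' := by
  rw [Nat.lt_iff_add_one_le, ← card_insert_of_notMem haB, codegree]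
  refine card_le_card fun z hz => ?_
  rw [mem_inter, mem_neighborFinset, mem_neighborFinset]
  rcases mem_insert.1 hz with rfl | hz
  exacts [⟨hy.symm, hy'.symm⟩, hB z hz]

lemma exists_common_neighbors {a c : V} (hac : a ≠ c) (h : 2 ≤ codegree G a c) :
    ∃ b d, IsFourCycle G a b c d := by
  obtain ⟨b, hb, d, hd, hbd⟩ := one_lt_card.1 h
  simp only [mem_inter, mem_neighborFinset] at hb hd
  exact ⟨b, d, hb.1, hb.2.symm, hd.2, hd.1.symm, hac, hbd⟩

lemma isFarPair_of_mem {a c y z : V} (hy : y ∈ G.neighborFinset a \ G.neighborFinset c)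
    (hz : z ∈ G.neighborFinset c \ G.neighborFinset a) (hyz : ¬ G.Adj y z) :
    IsFarPair G a c y z := by
  simp only [mem_sdiff, mem_neighborFinset] at hy hz
  exact ⟨hy.1, hz.1, hz.2, hy.2, hyz⟩

lemma codegree_le_three (hG : IsFiveRegularTriangleFree G) {a c : V} (hac : a ≠ c)
    (ha : ¬ ComponentColorable G a) : codegree G a c ≤ 3 := by
  by_contra! h4
  obtain ⟨b, d, h⟩ := exists_common_neighbors (G := G) hac (by omega)
  have hs := h.codegree_add_codegree_le_six hG ha
  have h2 : 2 ≤ codegree G b d := two_le_codegree hac h.ab.symm h.da h.bc h.cd.symm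
  have hb := not_componentColorable_of_adj ha h.ab
  have hY := three_le_card_sdiff hG (a := b) (c := d) (n := 3) (by omega)
  have hZ := three_le_card_sdiff hG (a := d) (c := b) (n := 3) (by rw [codegree_comm]; omega)
  have hjoin : ∀ y ∈ G.neighborFinset b \ G.neighborFinset d,
      ∀ z ∈ G.neighborFinset d \ G.neighborFinset b, G.Adj y z := by
    intro y hy z hz
    by_contra hyz
    refine hb (h.rotate.componentColorable_of_six_le hG (isFarPair_of_mem hy hz hyz) ?_)
    rw [codegree_comm c a]
    omega
  obtain ⟨y, hy, y', hy', hyy⟩ := one_lt_card.1 (Nat.lt_of_succ_lt hY)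
  obtain ⟨z, hz, z', hz', hzz⟩ := one_lt_card.1 (Nat.lt_of_succ_lt hZ)
  have hyb := (mem_neighborFinset ..).1 (mem_sdiff.1 hy).1
  have hyb' := (mem_neighborFinset ..).1 (mem_sdiff.1 hy').1
  have hzd := (mem_neighborFinset ..).1 (mem_sdiff.1 hz).1
  have hzd' := (mem_neighborFinset ..).1 (mem_sdiff.1 hz').1
  have hc : IsFourCycle G y z y' z' := ⟨hjoin y hy z hz, (hjoin y' hy' z hz).symm,
    hjoin y' hy' z' hz', (hjoin y hy z' hz').symm, hyy, hzz⟩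
  have := hc.codegree_add_codegree_le_six hG (not_componentColorable_of_adj hb hyb)
  have hnd := h.rotate.not_adj hG
  have h1 := card_lt_codegree (B := G.neighborFinset d \ G.neighborFinset b) hyb hyb'
    (by simpa using fun h => absurd h.symm hnd) fun z hz => ⟨hjoin y hy z hz, hjoin y' hy' z hz⟩
  have h2 := card_lt_codegree (B := G.neighborFinset b \ G.neighborFinset d) hzd hzd'
    (by simpa using fun h => absurd h hnd)
    fun y hy => ⟨(hjoin y hy z hz).symm, (hjoin y hy z' hz').symm⟩
  omega

/-- If `a` and `c` have exactly two common neighbors, then there are two disjoint far pairs. -/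
lemma IsFourCycle.exists_farPairs (hG : IsFiveRegularTriangleFree G) {a b c d : V}
    (h : IsFourCycle G a b c d) (ha : ¬ ComponentColorable G a) (hac : codegree G a c ≤ 2) :
    ∃ y z y' z', y ≠ y' ∧ z ≠ z' ∧ IsFarPair G a c y z ∧ IsFarPair G a c y' z' := by
  have hnac := h.not_adj hG
  have hc := not_componentColorable_of_adj (not_componentColorable_of_adj ha h.ab) h.bc
  have hY := three_le_card_sdiff hG (a := a) (c := c) (n := 3) (by omega)
  have hZ := three_le_card_sdiff hG (a := c) (c := a) (n := 3) (by rw [codegree_comm]; omega)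
  have key : ∀ {a c : V}, ¬ ComponentColorable G a → ¬ G.Adj c a → ∀ {A B : Finset V} (v : V),
      3 ≤ #A → A ⊆ G.neighborFinset a → 3 ≤ #B → B ⊆ G.neighborFinset c →
      ¬ ∀ y ∈ A.erase v, ∀ z ∈ B, G.Adj y z := by
    intro a c ha hca A B v hA hA' hB hB' hjoin
    obtain ⟨y, hy, y', hy', hyy⟩ := one_lt_card.1 (show 1 < #(A.erase v) by
      have := pred_card_le_card_erase (s := A) (a := v)
      omega)
    have hay := (mem_neighborFinset ..).1 (hA' (mem_of_mem_erase hy))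
    have hay' := (mem_neighborFinset ..).1 (hA' (mem_of_mem_erase hy'))
    have h1 := card_lt_codegree hay hay' (fun h => hca ((mem_neighborFinset ..).1 (hB' h)))
      fun z hz => ⟨hjoin y hy z hz, hjoin y' hy' z hz⟩
    have h2 := codegree_le_three hG hyy (not_componentColorable_of_adj ha hay)
    omega
  rcases exists_disjoint_not_adj (G := G) (card_pos.1 (by omega))
    (A := G.neighborFinset a \ G.neighborFinset c)
    (B := G.neighborFinset c \ G.neighborFinset a) with
    ⟨y, hy, y', hy', z, hz, z', hz', hyy, hzz, h1, h2⟩ | ⟨v, hv⟩ | ⟨v, hv⟩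
  · exact ⟨y, z, y', z', hyy, hzz, isFarPair_of_mem hy hz h1, isFarPair_of_mem hy' hz' h2⟩
  · exact absurd hv (key ha (fun h => hnac h.symm) v hY sdiff_subset hZ sdiff_subset)
  · exact absurd (fun z hz y hy => (hv z hz y hy).symm)
      (key hc hnac v hZ sdiff_subset hY sdiff_subset)

/-- If `a`, `c` have a further common neighbor `w` having a common neighbor with `b` other than `a`
and `c`, then `ab` has small degree in the conflict graph. -/
lemma IsFourCycle.componentColorable_of_third (hG : IsFiveRegularTriangleFree G) {a b c d w x : V}
    (h : IsFourCycle G a b c d) (hac : 3 ≤ codegree G a c) (hbd : 3 ≤ codegree G b d)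
    (haw : G.Adj a w) (hwc : G.Adj w c) (hwb : w ≠ b) (hwd : w ≠ d) (hwx : G.Adj w x)
    (hbx : G.Adj b x) (hxa : x ≠ a) (hxc : x ≠ c) : ComponentColorable G a := by
  have h3 : 3 ≤ codegree G w b := by
    have := card_lt_codegree (B := {c, x}) haw h.ab (by simp [h.ac, hxa.symm])
      (by simp [hwc, hwx, h.bc, hbx])
    rw [card_pair hxc.symm] at this
    omega
  have h1 := (degree_conflictGraph_of_cycle hG h.ab h.bc h.cd h.da h.ac h.bd).2 w haw hwc hwb hwd h3
  refine h.componentColorable_of_demand hG (M := ∅) (χ := fun _ => 0) (by simp [ProperOn])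
    (by simp) (by simp) (fun f hf => (demand_le_degree _ _ _).trans ?_)
    ⟨s(a, b), by simp [cycleEdges], (demand_le_degree _ _ _).trans (by omega)⟩
  have := h.degree_conflictGraph_le hG hf
  omega

/-- If `w` is a further common neighbor of `a` and `c`, then a common color for `by` and `ws`
lowers the demand of `ab`. -/
lemma IsFourCycle.componentColorable_of_farPair_at_third (hG : IsFiveRegularTriangleFree G)
    {a b c d w y s : V} (h : IsFourCycle G a b c d) (haw : G.Adj a w) (hcw : G.Adj c w)
    (hwb : w ≠ b) (hwd : w ≠ d) (p : IsFarPair G b w y s)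
    (h6 : 6 ≤ codegree G a c + codegree G b d) : ComponentColorable G a := by
  have hbw : ¬ G.Adj b w := hG.not_adj h.ab haw
  have hMC : ∀ e ∈ farPairEdges b w y s, e ∉ cycleEdges a b c d := by
    have hmem : ∀ e ∈ cycleEdges a b c d, ∀ x ∈ e, x = a ∨ x = b ∨ x = c ∨ x = d := by
      intro e he x hx
      rcases mem_cycleEdges.1 he with rfl | rfl | rfl | rfl <;>
        rcases Sym2.mem_iff.1 hx with rfl | rfl <;> simp
    intro e he he'
    rcases mem_farPairEdges.1 he with rfl | rfl
    · rcases hmem _ he' y (by simp) with rfl | rfl | rfl | rfl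
      exacts [p.not_cy haw.symm, p.ay.ne rfl, p.not_cy hcw.symm, h.rotate.not_adj hG p.ay]
    · rcases hmem _ he' w (by simp) with rfl | rfl | rfl | rfl
      exacts [haw.ne rfl, hwb rfl, hcw.ne rfl, hwd rfl]
  have hab : s(a, b) ∈ cycleEdges a b c d := by simp [cycleEdges]
  refine h.componentColorable_of_demand hG (M := farPairEdges b w y s) (χ := fun _ => 0)
    (fun e he f hf hef => absurd hef (p.not_conflictGraph_adj hwb.symm hbw he hf))
    (fun e he f hf x hxe hxf => p.eq_of_mem hwb.symm hbw he hf hxe hxf)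
    (disjoint_left.2 hMC) (fun f hf => (demand_le_degree _ _ _).trans ?_) ⟨s(a, b), hab, ?_⟩
  · have := h.degree_conflictGraph_le hG hf
    omega
  · have hsub : farPairEdges b w y s ⊆ (conflictGraph G).neighborFinset s(a, b) := by
      intro e he
      rw [mem_neighborFinset]
      refine ⟨fun h' => hMC e he (h' ▸ hab), h.ab, p.mem_edgeSet he, ?_⟩
      rcases mem_farPairEdges.1 he with rfl | rfl
      exacts [Or.inl ⟨b, by simp, by simp⟩, Or.inr ⟨a, w, by simp, by simp, haw⟩]
    have h1 := _root_.demand_add_card_le (c := fun _ => 0) hsub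
    have h2 : #((farPairEdges b w y s).image fun _ => (0 : Fin 37)) ≤ 1 :=
      card_le_one.2 (by simp)
    rw [p.card_farPairEdges hwb.symm hbw] at h1
    have h3 := h.degree_conflictGraph_le hG hab
    omega

/-- The subcase of `codegree_le_two` in which both diagonals have three common neighbors. -/
lemma IsFourCycle.componentColorable_of_three_three (hG : IsFiveRegularTriangleFree G)
    {a b c d : V} (h : IsFourCycle G a b c d) (hac : codegree G a c = 3)
    (hbd : codegree G b d = 3) : ComponentColorable G a := by
  by_contra ha
  have hnbd := h.rotate.not_adj hG
  obtain ⟨w, hw, hwbd⟩ : ∃ w ∈ G.neighborFinset a ∩ G.neighborFinset c,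
      w ∉ ({b, d} : Finset V) := by
    refine exists_mem_notMem_of_card_lt_card ?_
    rw [card_pair h.bd]
    exact hac.ge
  simp only [mem_inter, mem_neighborFinset, mem_insert, mem_singleton, not_or] at hw hwbd
  obtain ⟨⟨haw, hcw⟩, hwb, hwd⟩ := And.intro hw hwbd
  have hnear : ∀ s, G.Adj w s → s ≠ a → s ≠ c → ¬ G.Adj b s ∧ ¬ G.Adj d s :=
    fun s hs hsa hsc =>
      ⟨fun hbs => ha (h.componentColorable_of_third hG hac.ge hbd.ge haw hcw.symm hwb hwd hs hbs
        hsa hsc), fun hds => ha (h.reflect.componentColorable_of_third hG hac.ge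
          (codegree_comm d b ▸ hbd.ge) haw hcw.symm hwd hwb hs hds hsa hsc)⟩
  have hY := three_le_card_sdiff hG (a := b) (c := d) (n := 2) (by omega)
  have hZ := three_le_card_sdiff hG (a := d) (c := b) (n := 2) (by rw [codegree_comm]; omega)
  have hjoin : ∀ y ∈ G.neighborFinset b \ G.neighborFinset d,
      ∀ z ∈ G.neighborFinset d \ G.neighborFinset b, G.Adj y z := by
    intro y hy z hz
    by_contra hyz
    refine not_componentColorable_of_adj ha h.ab
      (h.rotate.componentColorable_of_six_le hG (isFarPair_of_mem hy hz hyz) ?_)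
    rw [codegree_comm c a]
    omega
  obtain ⟨y, hy⟩ := card_pos.1 (Nat.lt_of_succ_lt hY)
  have hby := (mem_neighborFinset ..).1 (mem_sdiff.1 hy).1
  have hdy : ¬ G.Adj d y := fun h => (mem_sdiff.1 hy).2 ((mem_neighborFinset ..).2 h)
  have hwb' : ¬ G.Adj b w := hG.not_adj h.ab haw
  have hsadj : ∀ s, G.Adj w s → s ≠ a → s ≠ c → G.Adj y s := by
    intro s hs hsa hsc
    by_contra hys
    have hya : y ≠ a := by rintro rfl; exact hdy h.da
    have hyc : y ≠ c := by rintro rfl; exact hdy h.cd.symm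
    have p : IsFarPair G b w y s :=
      ⟨hby, hs, (hnear s hs hsa hsc).1, fun hwy => (hnear y hwy hya hyc).1 hby, hys⟩
    exact ha (h.componentColorable_of_farPair_at_third hG haw hcw hwb hwd p (by omega))
  have hW : 3 ≤ #((G.neighborFinset w).erase a |>.erase c) := by
    have h1 := pred_card_le_card_erase (s := (G.neighborFinset w).erase a) (a := c)
    have h2 := pred_card_le_card_erase (s := G.neighborFinset w) (a := a)
    rw [hG.degree_eq] at h2
    omega
  set W := (G.neighborFinset w).erase a |>.erase c with hWdef
  have hWmem : ∀ s ∈ W, G.Adj w s ∧ s ≠ a ∧ s ≠ c := fun s hs => by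
    simp only [hWdef, mem_erase, mem_neighborFinset] at hs
    tauto
  have hdisj : Disjoint W (G.neighborFinset d \ G.neighborFinset b) := by
    refine disjoint_left.2 fun s hs hs' => ?_
    obtain ⟨h1, h2, h3⟩ := hWmem s hs
    simp only [mem_sdiff, mem_neighborFinset] at hs'
    exact (hnear s h1 h2 h3).2 hs'.1
  have hb : b ∉ W ∪ (G.neighborFinset d \ G.neighborFinset b) := by
    rw [mem_union, mem_sdiff, mem_neighborFinset]
    rintro (hb | hb)
    · exact hwb' (hWmem b hb).1.symm
    · exact hnbd hb.1.symm
  have hsub : insert b (W ∪ (G.neighborFinset d \ G.neighborFinset b)) ⊆ G.neighborFinset y := by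
    intro x hx
    rw [mem_neighborFinset]
    rcases mem_insert.1 hx with rfl | hx
    · exact hby.symm
    · rcases mem_union.1 hx with hx | hx
      · obtain ⟨h1, h2, h3⟩ := hWmem x hx
        exact hsadj x h1 h2 h3
      · exact hjoin y hy x hx
  have := card_le_card hsub
  rw [card_insert_of_notMem hb, card_union_of_disjoint hdisj, hG.degree_eq] at this
  omega

lemma codegree_le_two (hG : IsFiveRegularTriangleFree G) {a c : V} (hac : a ≠ c)
    (ha : ¬ ComponentColorable G a) : codegree G a c ≤ 2 := by
  by_contra! h3
  have h3' := codegree_le_three hG hac ha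
  obtain ⟨b, d, h⟩ := exists_common_neighbors hac (by omega : 2 ≤ codegree G a c)
  have hb := not_componentColorable_of_adj ha h.ab
  have hbd := codegree_le_three hG h.bd hb
  by_cases hbd' : codegree G b d ≤ 2
  · have h2 : 2 ≤ codegree G b d := two_le_codegree hac h.ab.symm h.da h.bc h.cd.symm
    obtain ⟨y, z, y', z', hy, hz, p, p'⟩ := h.rotate.exists_farPairs hG hb hbd'
    refine hb (h.rotate.componentColorable_of_five_le hG p p' hy hz ?_)
    rw [codegree_comm c a]
    omega
  · exact ha (h.componentColorable_of_three_three hG (by omega) (by omega))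

lemma codegree_le_one (hG : IsFiveRegularTriangleFree G) {a c : V} (hac : a ≠ c)
    (ha : ¬ ComponentColorable G a) : codegree G a c ≤ 1 := by
  by_contra! h2
  obtain ⟨b, d, h⟩ := exists_common_neighbors hac h2
  have hb := not_componentColorable_of_adj ha h.ab
  have h2' : 2 ≤ codegree G b d := two_le_codegree hac h.ab.symm h.da h.bc h.cd.symm
  have hnac := h.not_adj hG
  have hnbd := h.rotate.not_adj hG
  obtain ⟨y, z, y', z', hy, hz, p, p'⟩ := h.exists_farPairs hG ha (codegree_le_two hG hac ha)
  obtain ⟨u, v, -, -, -, -, q, -⟩ :=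
    h.rotate.exists_farPairs hG hb (codegree_le_two hG h.bd hb)
  set P := farPairEdges a c y z with hP
  set Q := farPairEdges b d u v with hQ
  have hPmem : ∀ e ∈ P, a ∈ e ∨ c ∈ e := fun e he => by
    rcases mem_farPairEdges.1 he with rfl | rfl <;> simp
  have hQC : Disjoint Q (cycleEdges a b c d) := by
    convert q.disjoint_cycleEdges h.rotate hnbd using 1
    ext e
    simp only [mem_cycleEdges]
    tauto
  have hPC := p.disjoint_cycleEdges h hnac
  have hPQ : ∀ e ∈ P, ∀ f ∈ Q, ∀ x, x ∈ e → x ∉ f := by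
    have h1 := h.ab
    have h2 := h.bc
    have h3 := h.cd
    have h4 := h.da
    intro e he f hf x hxe hxf
    have key : ∀ {a b y u : V}, G.Adj a b → G.Adj a y → G.Adj b u → s(a, y) ≠ s(a, b) →
        s(b, u) ≠ s(a, b) → x ∈ s(a, y) → x ∉ s(b, u) := by
      intro a b y u hab hay hbu hne hne' hx hx'
      rcases Sym2.mem_iff.1 hx with rfl | rfl <;> rcases Sym2.mem_iff.1 hx' with rfl | rfl
      exacts [hab.ne rfl, hne' Sym2.eq_swap, hne rfl, hG.not_adj hab hay hbu]
    have hP' : ∀ f ∈ cycleEdges a b c d, e ≠ f := fun f hf hef => disjoint_left.1 hPC he (hef ▸ hf)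
    have hQ' : ∀ e ∈ cycleEdges a b c d, f ≠ e := fun e he hef => disjoint_left.1 hQC hf (hef ▸ he)
    simp only [mem_cycleEdges] at hP' hQ'
    rcases mem_farPairEdges.1 he with rfl | rfl <;> rcases mem_farPairEdges.1 hf with rfl | rfl
    · exact key h.ab p.ay q.ay (hP' _ (by simp)) (hQ' _ (by simp)) hxe hxf
    · exact key h.da.symm p.ay q.cz (hP' _ (by simp)) (hQ' _ (by simp)) hxe hxf
    · exact key h.bc.symm p.cz q.ay (hP' _ (by simp)) (hQ' _ (by simp)) hxe hxf
    · exact key h.cd p.cz q.cz (hP' _ (by simp)) (hQ' _ (by simp)) hxe hxf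
  have hdisj : Disjoint P Q := disjoint_left.2 fun e he he' => by
    rcases hPmem e he with hx | hx
    exacts [hPQ e he e he' _ hx hx, hPQ e he e he' _ hx hx]
  have hmatch : ∀ e ∈ P ∪ Q, ∀ f ∈ P ∪ Q, ∀ x, x ∈ e → x ∈ f → e = f := by
    intro e he f hf x hxe hxf
    rcases mem_union.1 he with he | he <;> rcases mem_union.1 hf with hf | hf
    exacts [p.eq_of_mem h.ac hnac he hf hxe hxf, absurd hxf (hPQ e he f hf x hxe),
      absurd hxe (hPQ f hf e he x hxf), q.eq_of_mem h.bd hnbd he hf hxe hxf]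
  let χ : Sym2 V → Fin 37 := fun e => if e ∈ P then 0 else 1
  have hχP : ∀ e ∈ P, χ e = 0 := fun e he => if_pos he
  have hχQ : ∀ e ∈ Q, χ e = 1 := fun e he => if_neg (disjoint_right.1 hdisj he)
  have hcard : #((P ∪ Q).image χ) ≤ 2 := by
    refine (card_le_card (t := {0, 1}) fun i hi => ?_).trans card_le_two
    obtain ⟨e, -, rfl⟩ := mem_image.1 hi
    by_cases he : e ∈ P <;> simp [χ, he]
  have hcard' : #(P ∪ Q) = 4 := by
    rw [card_union_of_disjoint hdisj, p.card_farPairEdges h.ac hnac, q.card_farPairEdges h.bd hnbd]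
  have hMC : Disjoint (P ∪ Q) (cycleEdges a b c d) := disjoint_union_left.2 ⟨hPC, hQC⟩
  have hnew : ∀ {e f : Sym2 V} {x : V}, e ∈ P → x ∈ e → x ∈ f → f ≠ e → f ∉ P ∪ Q :=
    fun he hxe hxf hne hf => hne (hmatch _ hf _ (mem_union_left _ he) _ hxf hxe)
  refine ha (h.componentColorable_of_farPair hG (M := P ∪ Q) (χ := χ) ?_ hmatch hMC
    (fun f hf => ?_) p' ?_ ?_)
  · intro e he f hf hef
    rcases mem_union.1 he with he | he <;> rcases mem_union.1 hf with hf | hf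
    · exact absurd hef (p.not_conflictGraph_adj h.ac hnac he hf)
    · simp [hχP e he, hχQ f hf]
    · simp [hχQ e he, hχP f hf]
    · exact absurd hef (q.not_conflictGraph_adj h.bd hnbd he hf)
  · have := h.demand_add_card_le hG χ (fun e he => ?_) hMC hf
    · omega
    · rcases mem_union.1 he with he | he
      · exact ⟨p.mem_edgeSet he, farPairEdges_touch he⟩
      · refine ⟨q.mem_edgeSet he, ?_⟩
        rcases mem_farPairEdges.1 he with rfl | rfl
        exacts [⟨b, by simp⟩, ⟨d, by simp⟩]
  · exact hnew (mem_farPairEdges.2 (.inl rfl)) (x := a) (by simp) (by simp)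
      fun h => hy (Sym2.congr_right.1 h).symm
  · exact hnew (mem_farPairEdges.2 (.inr rfl)) (x := c) (by simp) (by simp)
      fun h => hz (Sym2.congr_right.1 h).symm

section Transversal

variable {U A B C D E : Finset V}

lemma exists_independent_transversal (hG : IsFiveRegularTriangleFree G) (hA : IsSparse G U A)
    (hB : IsSparse G U B) (hC : IsSparse G U C) (hD : IsSparse G U D) (hE : IsSparse G U E)
    (hA4 : #A = 4) (hB4 : #B = 4) (hC4 : #C = 4) (hD4 : #D = 4) (hE4 : #E = 4) :
    ∃ x ∈ A, ∃ z ∈ B, ∃ y ∈ C, ∃ p ∈ D, ∃ r ∈ E,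
      ¬ G.Adj x z ∧ ¬ G.Adj x y ∧ ¬ G.Adj x p ∧ ¬ G.Adj x r ∧ ¬ G.Adj z y ∧
      ¬ G.Adj z p ∧ ¬ G.Adj z r ∧ ¬ G.Adj y p ∧ ¬ G.Adj y r ∧ ¬ G.Adj p r := by
  have key : ∀ {X Y : Finset V} {x : V}, IsSparse G U X → IsSparse G U Y → #X = 4 → #Y = 4 →
      x ∈ U → (∀ y ∈ Y, ¬ G.Adj x y) →
      ∃ z ∈ X, ¬ G.Adj x z ∧ 3 ≤ #{y ∈ Y | ¬ G.Adj x y ∧ ¬ G.Adj z y} := by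
    intro X Y x hX hY hX4 hY4 hx hxY
    have h1 := hX.card_le_card_filter subset_rfl hx
    obtain ⟨z, hz⟩ := card_pos.1 (show 0 < #{y ∈ X | ¬ G.Adj x y} by omega)
    rw [mem_filter] at hz
    refine ⟨z, hz.1, hz.2, ?_⟩
    have h2 := hY.card_le_card_filter subset_rfl (hX.subset hz.1)
    rw [← filter_filter, filter_true_of_mem hxY]
    omega
  obtain ⟨x, hx⟩ := card_pos.1 (show 0 < #A by omega)
  have hxU := hA.subset hx
  by_cases hxC : ∀ y ∈ C, ¬ G.Adj x y
  · obtain ⟨z, hz, hxz, h3⟩ := key hB hC hB4 hC4 hxU hxC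
    obtain ⟨y, hy, p, hp, r, hr, h⟩ :=
      exists_independent_transversal_of_pair hA hB hC hD hE hD4 hE4 hx hz h3
    exact ⟨x, hx, z, hz, y, hy, p, hp, r, hr, by tauto⟩
  push Not at hxC
  obtain ⟨y, hy, hxy⟩ := hxC
  have hyU := hC.subset hy
  by_cases hyB : ∀ z ∈ B, ¬ G.Adj y z
  · obtain ⟨w, hw, hyw, h3⟩ := key hA hB hA4 hB4 hyU hyB
    obtain ⟨z, hz, p, hp, r, hr, h⟩ :=
      exists_independent_transversal_of_pair hC hA hB hD hE hD4 hE4 hy hw h3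
    have hwy : ¬ G.Adj w y := fun h => hyw h.symm
    have hzy : ¬ G.Adj z y := fun h' => h.1 h'.symm
    exact ⟨w, hw, z, hz, y, hy, p, hp, r, hr, by tauto⟩
  push Not at hyB
  obtain ⟨z, hz, hyz⟩ := hyB
  have hxz := hG.not_adj hxy.symm hyz
  have huniq : ∀ u ∈ U, G.Adj u y → ∀ y' ∈ C.erase y, ¬ G.Adj u y' := by
    intro u hu huy y' hy' huy'
    exact ne_of_mem_erase hy' (card_le_one.1 (hC.card_le u hu) y'
      (mem_filter.2 ⟨mem_of_mem_erase hy', huy'⟩) y (mem_filter.2 ⟨hy, huy⟩))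
  have h3 : 3 ≤ #{y ∈ C | ¬ G.Adj x y ∧ ¬ G.Adj z y} := by
    have : #(C.erase y) = 3 := by rw [card_erase_of_mem hy, hC4]
    rw [← this]
    exact card_le_card fun y' hy' => mem_filter.2 ⟨mem_of_mem_erase hy',
      huniq x hxU hxy y' hy', huniq z (hB.subset hz) hyz.symm y' hy'⟩
  obtain ⟨y, hy, p, hp, r, hr, h⟩ :=
    exists_independent_transversal_of_pair hA hB hC hD hE hD4 hE4 hx hz h3
  exact ⟨x, hx, z, hz, y, hy, p, hp, r, hr, by tauto⟩

end Transversal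

/-- Every connected component of a triangle-free 5-regular graph has a strong edge-coloring
with 37 colors. -/
theorem componentColorable (hG : IsFiveRegularTriangleFree G) (v : V) :
    ComponentColorable G v := by
  by_contra hv
  set w : Fin 5 → V := fun i => ((G.neighborFinset v).equivFinOfCardEq (hG.degree_eq v)).symm i
    with hw
  have hvw : ∀ i, G.Adj v (w i) := fun i => (mem_neighborFinset ..).1
    (((G.neighborFinset v).equivFinOfCardEq (hG.degree_eq v)).symm i).2
  have hinj : Function.Injective w := Subtype.val_injective.comp (Equiv.injective _)
  have hcod : ∀ i x, x ≠ w i → codegree G (w i) x ≤ 1 := fun i x hx =>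
    codegree_le_one hG hx.symm (not_componentColorable_of_adj hv (hvw i))
  have hsp : ∀ i, IsSparse G {x | x ≠ v ∧ ¬ G.Adj v x} ((G.neighborFinset (w i)).erase v) := by
    refine fun i => ⟨fun x hx => ?_, fun x hx => ?_⟩
    · rw [mem_erase, mem_neighborFinset] at hx
      rw [mem_filter]
      exact ⟨mem_univ _, hx.1, fun h => hG.not_adj (hvw i) h hx.2⟩
    · rw [mem_filter] at hx
      refine (card_le_card fun y hy => ?_).trans
        (hcod i x fun h => hx.2.2 (h ▸ hvw i))
      rw [mem_filter, mem_erase] at hy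
      rw [mem_inter, mem_neighborFinset (v := x)]
      exact ⟨hy.1.2, hy.2⟩
  have h4 : ∀ i, #((G.neighborFinset (w i)).erase v) = 4 := fun i => by
    rw [card_erase_of_mem ((mem_neighborFinset ..).2 (hvw i).symm), hG.degree_eq]
  obtain ⟨t, ht, htt⟩ : ∃ t : Fin 5 → V, (∀ i, t i ∈ (G.neighborFinset (w i)).erase v) ∧
      ∀ i j, ¬ G.Adj (t i) (t j) := by
    obtain ⟨x, hx, z, hz, y, hy, p, hp, r, hr, h⟩ := exists_independent_transversal hG
      (hsp 0) (hsp 1) (hsp 2) (hsp 3) (hsp 4) (h4 0) (h4 1) (h4 2) (h4 3) (h4 4)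
    refine ⟨![x, z, y, p, r], fun i => ?_, fun i j => ?_⟩
    · fin_cases i <;> assumption
    · fin_cases i <;> fin_cases j <;> simp [G.adj_comm, h]
  simp only [mem_erase, mem_neighborFinset] at ht
  have hww : ∀ i j, ¬ G.Adj (w i) (w j) := fun i j => hG.not_adj (hvw i) (hvw j)
  have hwt : ∀ i j, i ≠ j → ¬ G.Adj (w i) (t j) := fun i j hij h => by
    have h1 := hcod i (w j) (fun h => hij (hinj h.symm))
    have h2 := two_le_codegree (ht j).1 h (ht j).2 (hvw i).symm (hvw j).symm
    omega
  have hfar : ∀ i j, i ≠ j → IsFarPair G (w i) (w j) (t i) (t j) := fun i j hij =>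
    ⟨(ht i).2, (ht j).2, hwt i j hij, hwt j i hij.symm, htt i j⟩
  set M : Finset (Sym2 V) := univ.image fun i => s(w i, t i) with hM
  have hMmem : ∀ e ∈ M, ∃ i, e = s(w i, t i) := fun e he => by
    obtain ⟨i, -, rfl⟩ := mem_image.1 he
    exact ⟨i, rfl⟩
  have hcard : #M = 5 := by
    rw [hM, card_image_of_injective, card_univ, Fintype.card_fin]
    intro i j hij
    by_contra hne
    exact (hfar i j hne).edge_ne (fun h => hne (hinj h)) (hww i j) hij
  refine hv (componentColorable_of_star hG (M := M) (c := fun _ => 0) ?_ ?_ fun u hu => ?_)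
  · intro e he f hf hef
    obtain ⟨i, rfl⟩ := hMmem e he
    obtain ⟨j, rfl⟩ := hMmem f hf
    have hij : i ≠ j := by rintro rfl; exact hef.ne rfl
    exact absurd hef ((hfar i j hij).not_conflictGraph_adj (fun h => hij (hinj h)) (hww i j)
      (mem_farPairEdges.2 (.inl rfl)) (mem_farPairEdges.2 (.inr rfl)))
  · intro e he f hf x hxe hxf
    obtain ⟨i, rfl⟩ := hMmem e he
    obtain ⟨j, rfl⟩ := hMmem f hf
    by_cases hij : i = j
    · rw [hij]
    · exact (hfar i j hij).eq_of_mem (fun h => hij (hinj h)) (hww i j)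
        (mem_farPairEdges.2 (.inl rfl)) (mem_farPairEdges.2 (.inr rfl)) hxe hxf
  · have hsub : M ⊆ (conflictGraph G).neighborFinset s(v, u) := by
      intro e he
      obtain ⟨i, rfl⟩ := hMmem e he
      rw [mem_neighborFinset]
      refine ⟨fun h => ?_, hu, (ht i).2, Or.inr ⟨v, w i, by simp, by simp, hvw i⟩⟩
      have hv : v ∈ s(w i, t i) := h ▸ Sym2.mem_mk_left v u
      rcases Sym2.mem_iff.1 hv with h | h
      exacts [(hvw i).ne h, (ht i).1 h.symm]
    have h1 := demand_add_card_le (c := fun _ => 0) hsub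
    have h2 := degree_conflictGraph_le hG hu
    have h3 : #(M.image fun _ => (0 : Fin 37)) ≤ 1 := card_le_one.2 (by simp)
    omega

/-- The colorings of the components fit together to a coloring of the whole graph. -/
lemma exists_isStrongEdgeColoring (hG : IsFiveRegularTriangleFree G) :
    ∃ c : G.edgeSet → Fin 37, IsStrongEdgeColoring G c := by
  choose χ hχ using componentColorable hG
  let r : Sym2 V → V := fun e => (G.connectedComponentMk e.out.1).out
  have hr : ∀ e ∈ G.edgeSet, ∀ x ∈ e, G.Reachable e.out.1 x := by
    intro e he x hx
    have h1 : e.out.1 ∈ e := e.out_fst_mem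
    induction e with
    | _ p q =>
      have hpq : G.Adj p q := he
      rcases Sym2.mem_iff.1 h1 with h | h <;> rcases Sym2.mem_iff.1 hx with rfl | rfl <;> rw [h]
      exacts [hpq.reachable, hpq.symm.reachable]
  have hout : ∀ e : Sym2 V, G.Reachable (r e) e.out.1 := fun e =>
    ConnectedComponent.exact (Quot.out_eq _)
  have hmem : ∀ e ∈ G.edgeSet, e ∈ componentEdges G (r e) := fun e he => by
    simp only [componentEdges, mem_filter, mem_univ, true_and]
    exact ⟨he, e.out.1, e.out_fst_mem, hout e⟩
  refine ⟨fun e => χ (r e) e, fun e f hne hnear => ?_⟩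
  have hef : G.Reachable (e : Sym2 V).out.1 (f : Sym2 V).out.1 := by
    rcases hnear with ⟨x, hx, hx'⟩ | ⟨x, y, hx, hy, h⟩
    · exact (hr e e.2 x hx).trans (hr f f.2 x hx').symm
    · exact (hr e e.2 x hx).trans (h.reachable.trans (hr f f.2 y hy).symm)
  have hrr : r e = r f := by
    simp only [r, ConnectedComponent.sound hef]
  have hf := hmem f f.2
  rw [← hrr] at hf
  change χ (r e) e ≠ χ (r f) f
  rw [← hrr]
  exact hχ (r e) e (hmem e e.2) f hf ⟨fun h => hne (Subtype.ext h), e.2, f.2, hnear⟩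

end Graph

end

end

/-- If `G` is a 5-regular finite simple graph with girth 4, then `G` has a strong
edge-coloring that uses at most 37 colors. -/
theorem strong_edge_coloring_of_five_regular_girth_four {V : Type*} [Fintype V]
    (G : SimpleGraph V) [DecidableRel G.Adj]
    (hreg : G.IsRegularOfDegree 5) (hgirth : G.egirth = 4) :
    ∃ c : G.edgeSet → Fin 37, IsStrongEdgeColoring G c := by
  classical
  refine exists_isStrongEdgeColoring ⟨fun v => ?_, fun {a b c} hab hac hbc => ?_⟩
  · rw [← hreg v, card_neighborFinset_eq_degree]
    congr!
  · let p : G.Walk a a := .cons hab (.cons hbc (.cons hac.symm .nil))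
    have hp : p.IsCycle := by
      have h1 := hab.ne
      have h2 := hac.ne
      have h3 := hbc.ne
      simp [p, Walk.isCycle_def, Walk.isTrail_def, h1.symm, h2, h2.symm, h3, h1]
    have := le_egirth.1 hgirth.ge a p hp
    exact absurd this (by simp [p]; decide)
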